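/- arXiv:2411.10767 — 2 statements merged into one kernel-verified Lean document; each statement's English description precedes it below -/
import Mathlib

section
/- Let A be a finitary hereditary abelian category over a finite field. For any objects A, B of A and integers i > j, in the derived Hall algebra DH_0(A) of D^b(A) the product of the classes of the stalk complexes satisfies Z_A^{[i]} · Z_B^{[j]} = [Z_A^{[i]} ⊕ Z_B^{[j]}], i.e. the product equals the class of the direct sum complex. -/
/-!
STATEMENT 7.
In the derived Hall algebra `DH_0(A)` of the bounded derived category of a finitary
hereditary abelian category `A` over a finite field, for objects `a b` of `A` and
integers `i > j`, the product of the classes of the stalk complexes `Z_a^{[i]}` and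
`Z_b^{[j]}` equals the class of their direct sum:
`[Z_a^{[i]}] ⋄ [Z_b^{[j]}] = [Z_a^{[i]} ⊕ Z_b^{[j]}]`.
-/

open CategoryTheory CategoryTheory.Limits CategoryTheory.Pretriangulated ZeroObject

noncomputable section

namespace GreenDH

def IsoCl (C : Type*) [Category C] : Type _ := Quotient (CategoryTheory.isIsomorphicSetoid C)

def cl {C : Type*} [Category C] (X : C) : IsoCl C := Quotient.mk _ X

def IsoCl.out {C : Type*} [Category C] (s : IsoCl C) : C := Quotient.out s

def autCard {C : Type*} [Category C] (X : C) : ℕ := Nat.card (Aut X)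

variable (A : Type) [SmallCategory A] [Abelian A] [HasDerivedCategory.{0} A]

/-- `|Hom(Y, L)_X|` in the derived category: morphisms `Y ⟶ L` with cone isomorphic
to `X`. -/
def coneHomCard (Y L X : DerivedCategory A) : ℕ :=
  Nat.card {l : Y ⟶ L // ∃ (g : L ⟶ X) (h : X ⟶ Y⟦(1 : ℤ)⟧),
    Triangle.mk l g h ∈ distinguishedTriangles (C := DerivedCategory A)}

/-- `{X, Y} := ∏_{i > 0} |Hom(X[i], Y)|^{(-1)^i}`. -/
def brace (X Y : DerivedCategory A) : ℚ :=
  ∏ᶠ i : ℕ, if 0 < i then (Nat.card (X⟦(i : ℤ)⟧ ⟶ Y) : ℚ) ^ ((-1 : ℤ) ^ i) else 1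

/-- The derived Hall number `F^L_{XY}` of `DH_0(A)`. -/
def F0 (X Y L : DerivedCategory A) : ℚ :=
  (coneHomCard A Y L X : ℚ) / (autCard Y : ℚ) * (brace A Y L / brace A Y Y)

/-- The basis element `[X]` of the derived Hall algebra. -/
def delta (s : IsoCl (DerivedCategory A)) : IsoCl (DerivedCategory A) → ℚ :=
  open scoped Classical in fun x => if x = s then 1 else 0

/-- The multiplication of the derived Hall algebra `DH_0(A)`,
`[X] ⋄ [Y] = ∑_{[L]} F^L_{XY} [L]`, extended bilinearly from the basis. -/
def dhMul (u v : IsoCl (DerivedCategory A) → ℚ) : IsoCl (DerivedCategory A) → ℚ :=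
  fun L => ∑ᶠ X : IsoCl (DerivedCategory A), ∑ᶠ Y : IsoCl (DerivedCategory A),
    u X * v Y * F0 A X.out Y.out L.out

open DerivedCategory

section Helpers

variable {A}

lemma efface (X : A) (L : CochainComplex A ℤ) (hL : IsZero (L.X 0))
    (f : Q.obj ((CochainComplex.singleFunctor A 0).obj X) ⟶ Q.obj L) :
    ∃ (X' : A) (p : X' ⟶ X), Epi p ∧
      Q.map ((CochainComplex.singleFunctor A 0).map p) ≫ f = 0 := by
  obtain ⟨K, _, s, _, g, rfl⟩ := right_fac_of_isStrictlyLE f 0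
  let t : (CochainComplex.singleFunctor A 0).obj (K.X 0) ⟶ K :=
    HomologicalComplex.mkHomFromSingle (𝟙 (K.X 0))
      (fun k hk => (K.isZero_of_isStrictlyLE 0 k (by simp at hk; lia)).eq_of_tgt _ _)
  have htg : t ≫ g = 0 := by
    apply HomologicalComplex.from_single_hom_ext
    exact hL.eq_of_tgt _ _
  obtain ⟨p, hp⟩ := (CochainComplex.singleFunctor A 0).map_surjective (t ≫ s)
  refine ⟨K.X 0, p, ?_, ?_⟩
  · rw [Preadditive.epi_iff_cancel_zero]
    intro Z q hq
    have h0 : t ≫ s ≫ (CochainComplex.singleFunctor A 0).map q = 0 := by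
      rw [← Category.assoc, ← hp, ← Functor.map_comp, hq, Functor.map_zero]
    have ht : IsIso (t.f 0) := by
      have : t.f 0 = (HomologicalComplex.singleObjXSelf (ComplexShape.up ℤ) 0 (K.X 0)).hom := by
        simp [t]
        rfl
      rw [this]
      exact (HomologicalComplex.singleObjXSelf (ComplexShape.up ℤ) 0 (K.X 0)).isIso_hom
    have h1 : s ≫ (CochainComplex.singleFunctor A 0).map q = 0 := by
      apply HomologicalComplex.to_single_hom_ext
      rw [← cancel_epi (t.f 0)]
      have := congrArg (fun φ => HomologicalComplex.Hom.f φ 0) h0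
      exact this.trans comp_zero.symm
    have h2 : Q.map ((CochainComplex.singleFunctor A 0).map q) = 0 := by
      rw [← cancel_epi (Q.map s), ← Functor.map_comp, h1, Functor.map_zero, comp_zero]
    apply (DerivedCategory.singleFunctor A 0).map_injective
    rw [Functor.map_zero]
    exact h2
  · rw [hp, Functor.map_comp, Category.assoc, IsIso.hom_inv_id_assoc, ← Functor.map_comp, htg,
      Functor.map_zero]

lemma hom_zero_shift {X Y : A} {i j : ℤ} (m i' j' : ℤ) (hi : m + i = i') (hj : m + j = j')
    (h : ∀ f : (singleFunctor A i).obj X ⟶ (singleFunctor A j).obj Y, f = 0)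
    (f : (singleFunctor A i').obj X ⟶ (singleFunctor A j').obj Y) : f = 0 := by
  have h1 := h (((singleFunctors A).shiftIso m i i' hi).inv.app X ≫ f⟦m⟧' ≫
    ((singleFunctors A).shiftIso m j j' hj).hom.app Y)
  rw [← cancel_epi (((singleFunctors A).shiftIso m i i' hi).hom.app X),
    ← cancel_mono (((singleFunctors A).shiftIso m j j' hj).inv.app Y)] at h1
  simp only [Category.assoc, Iso.hom_inv_id_app_assoc, Iso.hom_inv_id_app, comp_zero,
    zero_comp] at h1
  apply (shiftFunctor (DerivedCategory A) m).map_injective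
  rw [Functor.map_zero]
  simpa using h1

lemma hom_zero_of_ge_two [HasExt.{0} A]
    (hered : ∀ X Y : A, Subsingleton (Abelian.Ext X Y 2)) (n : ℕ) :
    ∀ (X Y : A) (f : (singleFunctor A 0).obj X ⟶ (singleFunctor A (-(n + 2 : ℤ))).obj Y),
      f = 0 := by
  induction n with
  | zero =>
    intro X Y f
    have hs : Subsingleton (ShiftedHom ((singleFunctor A 0).obj X)
      ((singleFunctor A 0).obj Y) ((2 : ℕ) : ℤ)) :=
      (Abelian.Ext.homEquiv (X := X) (Y := Y) (n := 2)).symm.subsingleton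
    let φ := ((singleFunctors A).shiftIso ((2 : ℕ) : ℤ) (-(((0 : ℕ) : ℤ) + 2)) 0 (by simp)).app Y
    rw [← cancel_mono φ.inv]
    exact hs.elim _ _
  | succ n ih =>
    intro X Y f
    obtain ⟨X', p, hp, hpf⟩ := efface X
      ((CochainComplex.singleFunctor A (-(((n + 1 : ℕ) : ℤ) + 2))).obj Y)
      (HomologicalComplex.isZero_single_obj_X _ _ _ _ (by lia)) f
    let S : ShortComplex A := ShortComplex.mk (kernel.ι p) p (by simp)
    have hS : S.ShortExact :=
      { exact := ShortComplex.exact_of_f_is_kernel _ (kernelIsKernel p)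
        mono_f := by dsimp [S]; infer_instance
        epi_g := hp }
    obtain ⟨u, hu⟩ := Triangle.yoneda_exact₃ _ hS.singleTriangle_distinguished f hpf
    have hu0 : u = 0 := by
      let φ := ((singleFunctors A).shiftIso 1 (-1) 0 (by simp)).app (kernel p)
      have h := hom_zero_shift (-1) (-1) (-(((n + 1 : ℕ) : ℤ) + 2)) (by simp)
        (by push_cast; ring) (ih (kernel p) Y) (φ.inv ≫ u)
      exact (cancel_epi φ.inv).1 (h.trans comp_zero.symm)
    rw [hu, hu0]
    exact comp_zero

lemma hom_zero_ext [HasExt.{0} A]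
    (hered : ∀ X Y : A, Subsingleton (Abelian.Ext X Y 2)) (X Y : A) (i j : ℤ) (h : j + 2 ≤ i)
    (f : (singleFunctor A i).obj X ⟶ (singleFunctor A j).obj Y) : f = 0 := by
  obtain ⟨n, hn⟩ := Int.eq_ofNat_of_zero_le (sub_nonneg.2 h)
  exact hom_zero_shift i i j (by simp) (by lia) (hom_zero_of_ge_two hered n X Y) f

lemma hom_zero_neg (X Y : A) (i j : ℤ) (h : i < j)
    (f : (singleFunctor A i).obj X ⟶ (singleFunctor A j).obj Y) : f = 0 :=
  TStructure.t.zero f i j h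

lemma brace_eq_one (X Y : DerivedCategory A)
    (h : ∀ i : ℕ, 0 < i → ∀ f : X⟦(i : ℤ)⟧ ⟶ Y, f = 0) : brace A X Y = 1 := by
  apply finprod_eq_one_of_forall_eq_one
  intro i
  split_ifs with hi
  · have : Unique (X⟦(i : ℤ)⟧ ⟶ Y) := ⟨⟨0⟩, fun f => h i hi f⟩
    simp
  · rfl

lemma coneHomCard_eq_zero (X Y L : DerivedCategory A)
    (h1 : ∀ f : X ⟶ Y⟦(1 : ℤ)⟧, f = 0)
    (hL : ¬ Nonempty (L ≅ X ⊞ Y)) : coneHomCard A Y L X = 0 := by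
  have : IsEmpty {l : Y ⟶ L // ∃ (g : L ⟶ X) (h : X ⟶ Y⟦(1 : ℤ)⟧),
      Triangle.mk l g h ∈ distinguishedTriangles (C := DerivedCategory A)} := by
    constructor
    rintro ⟨l, g, h, hT⟩
    obtain ⟨e, -, -⟩ := exists_iso_binaryBiproduct_of_distTriang _ hT (h1 h)
    exact hL ⟨e ≪≫ biprod.braiding _ _⟩
  exact Nat.card_of_isEmpty

lemma coneHomCard_eq (X Y L : DerivedCategory A) [Finite (Y ⟶ Y)]
    (h1 : ∀ f : X ⟶ Y⟦(1 : ℤ)⟧, f = 0)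
    (h2 : ∀ f : Y ⟶ X, f = 0)
    (e : L ≅ X ⊞ Y) : coneHomCard A Y L X = autCard Y := by
  symm
  refine Nat.card_congr (Equiv.ofBijective (fun θ : Aut Y =>
    ⟨θ.hom ≫ biprod.inr ≫ e.inv, e.hom ≫ biprod.fst, 0, ?_⟩) ⟨?_, ?_⟩)
  · refine isomorphic_distinguished _ (binaryBiproductTriangle_distinguished Y X) _ ?_
    refine Triangle.isoMk _ _ θ (e ≪≫ biprod.braiding _ _) (Iso.refl _) ?_ ?_ ?_
    · change (θ.hom ≫ biprod.inr ≫ e.inv) ≫ e.hom ≫ (biprod.braiding X Y).hom =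
        θ.hom ≫ biprod.inl
      apply biprod.hom_ext <;> simp
    · change (e.hom ≫ biprod.fst) ≫ 𝟙 X = (e.hom ≫ (biprod.braiding X Y).hom) ≫ biprod.snd
      simp
    · change (0 : X ⟶ Y⟦(1 : ℤ)⟧) ≫ θ.hom⟦(1 : ℤ)⟧' = 𝟙 X ≫ 0
      rw [zero_comp, comp_zero]
  · intro θ θ' h
    have h' := congrArg (fun z => z.1 ≫ e.hom ≫ biprod.snd) h
    ext
    simpa using h'
  · rintro ⟨l, g, h, hT⟩
    obtain ⟨e', he', -⟩ := exists_iso_binaryBiproduct_of_distTriang _ hT (h1 h)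
    change L ≅ Y ⊞ X at e'
    change l ≫ e'.hom = biprod.inl at he'
    let f : Y ⟶ Y := l ≫ e.hom ≫ biprod.snd
    have hf : l = f ≫ biprod.inr ≫ e.inv := by
      rw [← cancel_mono e.hom]
      apply biprod.hom_ext
      · rw [h2 ((l ≫ e.hom) ≫ biprod.fst)]
        simp
      · simp [f]
    let r : Y ⟶ Y := biprod.inr ≫ e.inv ≫ e'.hom ≫ biprod.fst
    have hfr : f ≫ r = 𝟙 Y := by
      have : l ≫ e'.hom ≫ biprod.fst = 𝟙 Y := by
        rw [← Category.assoc, he']; simp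
      rw [hf] at this
      simpa [r] using this
    have hrf : r ≫ f = 𝟙 Y := by
      have : Finite (End Y) := inferInstanceAs (Finite (Y ⟶ Y))
      have h3 : (End.of r) * (End.of f) = 1 := hfr
      exact mul_eq_one_comm.1 h3
    exact ⟨⟨f, r, hfr, hrf⟩, Subtype.ext hf.symm⟩

open scoped Classical in
lemma F0_eq (X Y L : DerivedCategory A) [Finite (Y ⟶ Y)]
    (h1 : ∀ f : X ⟶ Y⟦(1 : ℤ)⟧, f = 0)
    (h2 : ∀ f : Y ⟶ X, f = 0)
    (h3 : ∀ i : ℕ, 0 < i → ∀ f : Y⟦(i : ℤ)⟧ ⟶ Y, f = 0)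
    (h4 : ∀ i : ℕ, 0 < i → ∀ f : Y⟦(i : ℤ)⟧ ⟶ X, f = 0) :
    F0 A X Y L = if Nonempty (L ≅ X ⊞ Y) then 1 else 0 := by
  unfold F0
  split_ifs with h
  · obtain ⟨e⟩ := h
    rw [coneHomCard_eq X Y L h1 h2 e, brace_eq_one Y Y h3, brace_eq_one Y L ?_, div_self]
    · simp
    · have : Finite (Aut Y) := Finite.of_injective (fun θ : Aut Y => (θ.hom : Y ⟶ Y))
        (fun θ θ' h => by ext; exact h)
      have : Nonempty (Aut Y) := ⟨Iso.refl _⟩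
      unfold autCard
      exact_mod_cast Nat.card_pos.ne'
    · intro i hi f
      rw [← cancel_mono e.hom]
      apply biprod.hom_ext
      · rw [h4 i hi ((f ≫ e.hom) ≫ biprod.fst)]; simp
      · rw [h3 i hi ((f ≫ e.hom) ≫ biprod.snd)]; simp
  · rw [coneHomCard_eq_zero X Y L h1 h]; simp

end Helpers

theorem stalk_product_is_direct_sum
    (k : Type) [Field k] [Fintype k]
    (A : Type) [SmallCategory A] [Abelian A] [CategoryTheory.Linear k A]
    [HasExt.{0} A] [HasDerivedCategory.{0} A] [HasBinaryBiproducts (DerivedCategory A)]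
    (hfinHom : ∀ X Y : A, Finite (X ⟶ Y))
    (hfinExt : ∀ X Y : A, Finite (Abelian.Ext X Y 1))
    (hered : ∀ X Y : A, Subsingleton (Abelian.Ext X Y 2))
    (a b : A) (i j : ℤ) (hij : i > j) :
    dhMul A (delta A (cl ((DerivedCategory.singleFunctor A i).obj a)))
        (delta A (cl ((DerivedCategory.singleFunctor A j).obj b)))
      = delta A (cl ((DerivedCategory.singleFunctor A i).obj a ⊞
          (DerivedCategory.singleFunctor A j).obj b)) := by
  classical
  set X₀ := (DerivedCategory.singleFunctor A i).obj a
  set Y₀ := (DerivedCategory.singleFunctor A j).obj b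
  obtain ⟨eX⟩ : Nonempty ((cl X₀).out ≅ X₀) := Quotient.mk_out (s := isIsomorphicSetoid _) X₀
  obtain ⟨eY⟩ : Nonempty ((cl Y₀).out ≅ Y₀) := Quotient.mk_out (s := isIsomorphicSetoid _) Y₀
  funext L
  have hfinY : Finite ((cl Y₀).out ⟶ (cl Y₀).out) := by
    have : Finite (Y₀ ⟶ Y₀) := by
      have := hfinHom b b
      exact Finite.of_surjective _ ((DerivedCategory.singleFunctor A j).map_surjective (X := b) (Y := b))
    exact Finite.of_equiv _ (Iso.homCongr eY eY).symm
  have hshift : ∀ n : ℤ, Nonempty ((cl Y₀).out⟦n⟧ ≅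
      (DerivedCategory.singleFunctor A (j - n)).obj b) := fun n =>
    ⟨(shiftFunctor _ n).mapIso eY ≪≫
      ((singleFunctors A).shiftIso n (j - n) j (by ring)).app b⟩
  have key := F0_eq (cl X₀).out (cl Y₀).out L.out
    (fun f => by
      obtain ⟨e⟩ := hshift 1
      rw [← cancel_epi eX.inv, ← cancel_mono e.hom, comp_zero, zero_comp]
      exact hom_zero_ext hered _ _ _ _ (by lia) _)
    (fun f => by
      rw [← cancel_epi eY.inv, ← cancel_mono eX.hom, comp_zero, zero_comp]
      exact hom_zero_neg _ _ _ _ hij _)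
    (fun n hn f => by
      obtain ⟨e⟩ := hshift n
      rw [← cancel_epi e.inv, ← cancel_mono eY.hom, comp_zero, zero_comp]
      exact hom_zero_neg _ _ _ _ (by lia) _)
    (fun n hn f => by
      obtain ⟨e⟩ := hshift n
      rw [← cancel_epi e.inv, ← cancel_mono eX.hom, comp_zero, zero_comp]
      exact hom_zero_neg _ _ _ _ (by lia) _)
  have hiff : Nonempty (L.out ≅ (cl X₀).out ⊞ (cl Y₀).out) ↔ L = cl (X₀ ⊞ Y₀) := by
    have hL : L = cl L.out := (Quotient.out_eq L).symm
    constructor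
    · rintro ⟨e⟩
      rw [hL]
      exact Quotient.sound (s := isIsomorphicSetoid _) ⟨e ≪≫ biprod.mapIso eX eY⟩
    · intro h
      rw [hL] at h
      obtain ⟨e⟩ := Quotient.exact (s := isIsomorphicSetoid _) h
      exact ⟨e ≪≫ (biprod.mapIso eX eY).symm⟩
  unfold dhMul
  rw [finsum_eq_single _ (cl X₀) (fun x hx => by simp [delta, hx]),
    finsum_eq_single _ (cl Y₀) (fun y hy => by simp [delta, hy]), key]
  simp [delta, hiff]

end GreenDH
end
end

section
/- Let A be a finitary hereditary abelian category over a finite field, t an odd positive integer, A_1^•, A_2^•, X^• t-periodic complexes with zero differentials and components A_1^i, A_2^i, X^i, and fix S^i ∈ A for i ∈ Z_t. Let ε be the disjoint union, over isomorphism classes of t-periodic complexes C^• with H(C^•) ≅ X^• in D_t(A) and Im(d^i_{C^•}) ≅ S^{i+1} for all i ∈ Z_t, of the sets Ext^1_{C_t(A)}(A_1^•, A_2^•)_{C^•}. Then |ε| = ∑_{[M^j],[N^j] ∈ Iso(A), j∈Z_t} ∏_{i∈Z_t} ( g^{A_1^i}_{S^{i+1} M^i} · g^{X^i}_{M^i N^i}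 · g^{A_2^i}_{N^i S^i} · a_{M^i} a_{N^i} a_{S^i} · |Hom_A(A_1^i, A_2^i)| ) / ( a_{X^i} · ⟨A_1^i, S^i⟩ · ⟨S^{i+1}, N^i⟩ ). -/
/-!
STATEMENT 17.
With the notation of Statement 16, the cardinality of the set `ε` (the disjoint union,
over isomorphism classes of `t`-periodic complexes `C^•` with `H(C^•) ≅ X^•` and
`Im(d^i) ≅ S^{i+1}`, of the sets of extension classes `Ext¹_{C_t(A)}(A₁^•, A₂^•)_{C^•}`)
equals
`∑_{[M^j],[N^j]} ∏_i g^{A₁^i}_{S^{i+1} M^i} g^{X^i}_{M^i N^i} g^{A₂^i}_{N^i S^i}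
   a_{M^i} a_{N^i} a_{S^i} |Hom(A₁^i, A₂^i)| / (a_{X^i} ⟨A₁^i, S^i⟩ ⟨S^{i+1}, N^i⟩)`.
-/

open CategoryTheory CategoryTheory.Limits

noncomputable section

namespace GreenDH

def homCard {C : Type*} [Category C] (X Y : C) : ℕ := Nat.card (X ⟶ Y)

def ext1Card {A : Type} [SmallCategory A] [Abelian A] [HasExt.{0} A] (X Y : A) : ℕ :=
  Nat.card (Abelian.Ext X Y 1)

/-- The multiplicative Euler form `⟨X, Y⟩ = |Hom(X,Y)| / |Ext¹(X,Y)|`. -/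
def euler {A : Type} [SmallCategory A] [Abelian A] [HasExt.{0} A] (X Y : A) : ℚ :=
  (homCard X Y : ℚ) / (ext1Card X Y : ℚ)

def hall {A : Type} [SmallCategory A] [Abelian A] (a b c : A) : ℕ :=
  Nat.card {S : Subobject c // Nonempty ((S : A) ≅ b) ∧ Nonempty ((cokernel S.arrow) ≅ a)}

/-- Short exact sequences `0 → b → c → a → 0` with middle term `c`. -/
def sesSet {C : Type*} [Category C] [Abelian C] (a b c : C) : Type _ :=
  {p : (b ⟶ c) × (c ⟶ a) // ∃ w : p.1 ≫ p.2 = 0, (ShortComplex.mk p.1 p.2 w).ShortExact}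

/-- `Ext¹(a, b)_c`: extension classes of `a` by `b` with middle term isomorphic to `c`. -/
def extWithMiddle {C : Type*} [Category C] [Abelian C] (a b c : C) : Type _ :=
  Quot (fun (p q : sesSet a b c) =>
    ∃ l : c ≅ c, p.1.1 ≫ l.hom = q.1.1 ∧ l.hom ≫ q.1.2 = p.1.2)

def pShape (t : ℕ) : ComplexShape (ZMod t) := ComplexShape.up' (1 : ZMod t)

abbrev Ct (A : Type) [SmallCategory A] [Abelian A] (t : ℕ) :=
  HomologicalComplex A (pShape t)

def mkZero {A : Type} [SmallCategory A] [Abelian A] {t : ℕ} (f : ZMod t → A) : Ct A t where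
  X := f
  d _ _ := 0
  shape _ _ _ := rfl
  d_comp_d' := by intros; simp

variable {A : Type} [SmallCategory A] [Abelian A] {t : ℕ}

/-- The index of the disjoint union `ε`. -/
def epsIdx (X S : ZMod t → A) : Type _ :=
  {c : IsoCl (Ct A t) //
    (∀ i : ZMod t, Nonempty ((IsoCl.out c).homology i ≅ X i)) ∧
    (∀ i : ZMod t, Nonempty (Limits.image ((IsoCl.out c).d i (i + 1)) ≅ S (i + 1)))}

/-- The set `ε`. -/
def eps (A1 A2 X S : ZMod t → A) : Type _ :=
  Σ c : epsIdx X S, extWithMiddle (mkZero A1) (mkZero A2) c.1.out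

section real
open DerivedCategory Pretriangulated Abelian

universe w v u

lemma exists_ses {C : Type u} [Category.{v} C] [Abelian C] [HasExt.{w} C] {A B : C}
    (ξ : Ext A B 1) : ∃ (E : C) (i : B ⟶ E) (p : E ⟶ A) (w : i ≫ p = 0)
      (h : (ShortComplex.mk i p w).ShortExact), h.extClass = ξ := by
  let := HasDerivedCategory.standard C
  let δ : (singleFunctor C 0).obj A ⟶ ((singleFunctor C 0).obj B)⟦(1:ℤ)⟧ := ξ.hom
  obtain ⟨E', i', p', hT⟩ := distinguished_cocone_triangle₂ δ
  have hz : ∀ (n : ℤ), n ≠ 0 → ∀ Z : C,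
      IsZero ((homologyFunctor C n).obj ((singleFunctor C 0).obj Z)) := by
    intro n hn Z
    rcases lt_or_gt_of_ne hn with h | h
    · exact isZero_of_isGE _ 0 n h
    · exact isZero_of_isLE _ 0 n h
  have hE' : ∀ n : ℤ, n ≠ 0 → IsZero ((homologyFunctor C n).obj E') := by
    intro n hn
    exact (HomologySequence.exact₂ _ hT n).isZero_of_both_zeros
      ((hz n hn _).eq_of_src _ _) ((hz n hn _).eq_of_tgt _ _)
  have : E'.IsGE 0 := (isGE_iff _ _).2 fun i hi => hE' i hi.ne
  have : E'.IsLE 0 := (isLE_iff _ _).2 fun i hi => hE' i hi.ne'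
  obtain ⟨E, ⟨e⟩⟩ := exists_iso_singleFunctor_obj_of_isGE_of_isLE E' 0
  obtain ⟨i, hi⟩ := (singleFunctor C 0).map_surjective (i' ≫ e.hom)
  obtain ⟨p, hp⟩ := (singleFunctor C 0).map_surjective (e.inv ≫ p')
  have hT2 : Triangle.mk ((singleFunctor C 0).map i) ((singleFunctor C 0).map p) δ ∈
      distTriang (DerivedCategory C) := by
    refine isomorphic_distinguished _ hT _ (Iso.symm ?_)
    refine Triangle.isoMk _ _ (Iso.refl _) e (Iso.refl _) ?_ ?_ ?_
    · change i' ≫ e.hom = 𝟙 _ ≫ (singleFunctor C 0).map i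
      rw [hi, Category.id_comp]
    · change p' ≫ 𝟙 _ = e.hom ≫ (singleFunctor C 0).map p
      rw [hp, Category.comp_id, Iso.hom_inv_id_assoc]
    · change δ ≫ (shiftFunctor (DerivedCategory C) (1 : ℤ)).map (𝟙 _) = 𝟙 _ ≫ δ
      rw [CategoryTheory.Functor.map_id, Category.id_comp, Category.comp_id]
  have w : i ≫ p = 0 := by
    apply (singleFunctor C 0).map_injective
    rw [Functor.map_comp, Functor.map_zero]
    exact comp_distTriang_mor_zero₁₂ _ hT2
  have h : (ShortComplex.mk i p w).ShortExact := by
    have m : Mono ((homologyFunctor C 0).map ((singleFunctor C 0).map i)) :=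
      (HomologySequence.mono_homologyMap_mor₁_iff _ hT2 (-1) 0 (by lia)).2
        ((hz (-1) (by lia) _).eq_of_src _ _)
    have ep : Epi ((homologyFunctor C 0).map ((singleFunctor C 0).map p)) :=
      (HomologySequence.epi_homologyMap_mor₂_iff _ hT2 0 1 (by lia)).2
        ((hz 1 (by lia) _).eq_of_tgt _ _)
    have ex := HomologySequence.exact₂ _ hT2 0
    let φ := singleFunctorCompHomologyFunctorIso C 0
    have ni := φ.hom.naturality i
    have np := φ.hom.naturality p
    dsimp at ni np
    refine { exact := ?_, mono_f := ?_, epi_g := ?_ }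
    · refine ShortComplex.exact_of_iso ?_ ex
      exact ShortComplex.isoMk (φ.app _) (φ.app _) (φ.app _) ni.symm np.symm
    · change Mono i
      have : i = φ.inv.app _ ≫ (homologyFunctor C 0).map ((singleFunctor C 0).map i) ≫ φ.hom.app _ := by
        rw [ni]; simp
      rw [this]
      infer_instance
    · change Epi p
      have : p = φ.inv.app _ ≫ (homologyFunctor C 0).map ((singleFunctor C 0).map p) ≫ φ.hom.app _ := by
        rw [np]; simp
      rw [this]
      infer_instance
  refine ⟨E, i, p, w, h, ?_⟩
  ext
  rw [h.extClass_hom]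
  obtain ⟨c, hc1, hc2⟩ := complete_distinguished_triangle_morphism _ _ h.singleTriangle_distinguished
    hT2 (𝟙 _) (𝟙 _) ((Category.comp_id _).trans (Category.id_comp _).symm)
  obtain ⟨c, rfl⟩ := (singleFunctor C 0).map_surjective c
  have : Epi p := h.epi_g
  have hc : c = 𝟙 _ := by
    rw [← cancel_epi p]
    apply (singleFunctor C 0).map_injective
    rw [Functor.map_comp]
    exact (hc1.trans (Category.id_comp _)).trans (by rw [Category.comp_id]; rfl)
  subst hc
  change h.singleδ ≫ (shiftFunctor (DerivedCategory C) (1 : ℤ)).map (𝟙 _) =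
    (singleFunctor C 0).map (𝟙 _) ≫ δ at hc2
  rw [CategoryTheory.Functor.map_id, CategoryTheory.Functor.map_id, Category.id_comp, Category.comp_id] at hc2
  exact hc2
end real

section ext
open Abelian

variable {C : Type} [SmallCategory C] [Abelian C]

lemma sesSet.mono {a b c : C} (s : sesSet a b c) : Mono s.1.1 := s.2.choose_spec.mono_f
lemma sesSet.epi {a b c : C} (s : sesSet a b c) : Epi s.1.2 := s.2.choose_spec.epi_g
lemma sesSet.w {a b c : C} (s : sesSet a b c) : s.1.1 ≫ s.1.2 = 0 := s.2.choose
lemma sesSet.ses {a b c : C} (s : sesSet a b c) :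
    (ShortComplex.mk s.1.1 s.1.2 s.w).ShortExact := s.2.choose_spec

lemma sesSet.lift {a b c z : C} (s : sesSet a b c) (k : z ⟶ c) (hk : k ≫ s.1.2 = 0) :
    ∃ l : z ⟶ b, l ≫ s.1.1 = k :=
  ⟨s.ses.fIsKernel.lift (KernelFork.ofι k hk),
    s.ses.fIsKernel.fac (KernelFork.ofι k hk) WalkingParallelPair.zero⟩

lemma sesSet.desc {a b c z : C} (s : sesSet a b c) (k : c ⟶ z) (hk : s.1.1 ≫ k = 0) :
    ∃ l : a ⟶ z, s.1.2 ≫ l = k :=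
  ⟨s.ses.gIsCokernel.desc (CokernelCofork.ofπ k hk),
    s.ses.gIsCokernel.fac (CokernelCofork.ofπ k hk) WalkingParallelPair.one⟩

/-- A morphism of short exact sequences which is an isomorphism on the ends is an isomorphism. -/
lemma ses_isIso {a b c a' b' c' : C} (s : sesSet a b c) (s' : sesSet a' b' c')
    (α : a ⟶ a') (β : b ⟶ b') (e : c ⟶ c') [IsIso α] [IsIso β]
    (h1 : s.1.1 ≫ e = β ≫ s'.1.1) (h2 : e ≫ s'.1.2 = s.1.2 ≫ α) : IsIso e := by
  let φ : ShortComplex.mk s.1.1 s.1.2 s.w ⟶ ShortComplex.mk s'.1.1 s'.1.2 s'.w :=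
    { τ₁ := β, τ₂ := e, τ₃ := α, comm₁₂ := h1.symm, comm₂₃ := h2 }
  have : IsIso φ.τ₁ := ‹IsIso β›
  have : IsIso φ.τ₃ := ‹IsIso α›
  exact ShortComplex.isIso₂_of_shortExact_of_isIso₁₃ φ s.ses s'.ses

variable [HasExt.{0} C]

/-- The extension class. -/
def cls {a b c : C} (s : sesSet a b c) : Ext a b 1 := s.ses.extClass

def pull {a a' b : C} (α : a' ⟶ a) (ξ : Ext a b 1) : Ext a' b 1 :=
  (Ext.mk₀ α).comp ξ (zero_add 1)

def push {a b b' : C} (ξ : Ext a b 1) (β : b ⟶ b') : Ext a b' 1 :=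
  ξ.comp (Ext.mk₀ β) (add_zero 1)

lemma push_pull {a a' b b' : C} (α : a' ⟶ a) (ξ : Ext a b 1) (β : b ⟶ b') :
    push (pull α ξ) β = pull α (push ξ β) := by
  unfold push pull
  exact Ext.comp_assoc _ _ _ _ _ (by lia)

lemma exists_cls {a b : C} (ξ : Ext a b 1) : ∃ (c : C) (s : sesSet a b c), cls s = ξ := by
  obtain ⟨E, i, p, w, h, e⟩ := exists_ses ξ
  exact ⟨E, ⟨(i, p), w, h⟩, e⟩

lemma cls_natural {a b c a' b' c' : C} (s : sesSet a b c) (s' : sesSet a' b' c')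
    (α : a ⟶ a') (β : b ⟶ b') (e : c ⟶ c')
    (h1 : s.1.1 ≫ e = β ≫ s'.1.1) (h2 : e ≫ s'.1.2 = s.1.2 ≫ α) :
    push (cls s) β = pull α (cls s') := by
  let φ : ShortComplex.mk s.1.1 s.1.2 s.w ⟶ ShortComplex.mk s'.1.1 s'.1.2 s'.w :=
    { τ₁ := β, τ₂ := e, τ₃ := α, comm₁₂ := h1.symm, comm₂₃ := h2 }
  exact ShortComplex.ShortExact.extClass_naturality s.ses s'.ses φ

lemma exists_map {a b c a' b' c' : C} (s : sesSet a b c) (s' : sesSet a' b' c')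
    (α : a ⟶ a') (β : b ⟶ b') (h : push (cls s) β = pull α (cls s')) :
    ∃ e : c ⟶ c', s.1.1 ≫ e = β ≫ s'.1.1 ∧ e ≫ s'.1.2 = s.1.2 ≫ α := by
  have h0 : (Ext.mk₀ (s.1.2 ≫ α)).comp s'.ses.extClass (zero_add 1) = 0 := by
    rw [← Ext.mk₀_comp_mk₀_assoc]
    change (Ext.mk₀ s.1.2).comp (pull α (cls s')) _ = 0
    rw [← h]
    exact s.ses.comp_extClass_assoc (Ext.mk₀ β) (add_zero 1)
  obtain ⟨x, hx⟩ := Ext.covariant_sequence_exact₃ _ s'.ses (Ext.mk₀ (s.1.2 ≫ α)) (zero_add 1) h0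
  obtain ⟨l, rfl⟩ := (Ext.mk₀_bijective _ _).2 x
  rw [Ext.mk₀_comp_mk₀] at hx
  have hl : l ≫ s'.1.2 = s.1.2 ≫ α := (Ext.mk₀_bijective _ _).1 hx
  obtain ⟨u, hu⟩ := s'.lift (s.1.1 ≫ l) (by rw [Category.assoc, hl, ← Category.assoc, s.w, zero_comp])
  have hn := cls_natural s s' α u l hu.symm hl
  have h1 : s.ses.extClass.comp (Ext.mk₀ (β - u)) (add_zero 1) = 0 := by
    rw [sub_eq_add_neg, Ext.mk₀_add, Ext.comp_add, Ext.mk₀_neg, Ext.comp_neg, ← sub_eq_add_neg,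
      sub_eq_zero]
    exact h.trans hn.symm
  obtain ⟨y, hy⟩ := Ext.contravariant_sequence_exact₁ s.ses _ (Ext.mk₀ (β - u)) (add_zero 1) h1
  obtain ⟨v, rfl⟩ := (Ext.mk₀_bijective _ _).2 y
  rw [Ext.mk₀_comp_mk₀] at hy
  have hv : s.1.1 ≫ v = β - u := (Ext.mk₀_bijective _ _).1 hy
  refine ⟨l + v ≫ s'.1.1, ?_, ?_⟩
  · rw [Preadditive.comp_add, ← Category.assoc s.1.1 v, hv, ← hu, Preadditive.sub_comp]
    abel
  · rw [Preadditive.add_comp, hl, Category.assoc, s'.w, comp_zero, add_zero]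

lemma cls_eq_iff {a b c c' : C} (s : sesSet a b c) (s' : sesSet a b c') :
    cls s = cls s' ↔ ∃ l : c ≅ c', s.1.1 ≫ l.hom = s'.1.1 ∧ l.hom ≫ s'.1.2 = s.1.2 := by
  constructor
  · intro h
    obtain ⟨e, h1, h2⟩ := exists_map s s' (𝟙 _) (𝟙 _) (by simpa [push, pull] using h)
    have := ses_isIso s s' (𝟙 _) (𝟙 _) e h1 h2
    exact ⟨asIso e, by simpa using h1, by simpa using h2⟩
  · rintro ⟨l, h1, h2⟩
    have := cls_natural s s' (𝟙 _) (𝟙 _) l.hom (by simpa using h1) (by simpa using h2)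
    simpa [push, pull] using this

/-- transport along an isomorphism of the middle term -/
def sesSet.trans {D : Type*} [Category D] [Abelian D] {a b c c' : D} (s : sesSet a b c)
    (e : c ≅ c') : sesSet a b c' :=
  ⟨(s.1.1 ≫ e.hom, e.inv ≫ s.1.2), by
    obtain ⟨w, hs⟩ := s.2
    refine ⟨by simp [w], ?_⟩
    refine ShortComplex.shortExact_of_iso ?_ hs
    exact ShortComplex.isoMk (Iso.refl _) e (Iso.refl _) (by simp) (by simp)⟩

lemma cls_trans {a b c c' : C} (s : sesSet a b c) (e : c ≅ c') : cls (s.trans e) = cls s := by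
  symm
  rw [cls_eq_iff]
  exact ⟨e, rfl, by simp [sesSet.trans]⟩

end ext

section ried
open Abelian

variable {C : Type} [SmallCategory C] [Abelian C]

lemma card_of_fiber {α β γ : Type} (F : α → β) (h : ∀ b, Nonempty ({x // F x = b} ≃ γ)) :
    Nat.card α = Nat.card β * Nat.card γ := by
  rw [← Nat.card_prod]
  exact Nat.card_congr ((Equiv.sigmaFiberEquiv F).symm.trans
    ((Equiv.sigmaCongrRight fun b => (h b).some).trans (Equiv.sigmaEquivProd β γ)))

def unip {a b c : C} (s : sesSet a b c) (h : a ⟶ b) : c ≅ c where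
  hom := 𝟙 c + s.1.2 ≫ h ≫ s.1.1
  inv := 𝟙 c - s.1.2 ≫ h ≫ s.1.1
  hom_inv_id := by
    have := s.w
    simp [reassoc_of% this]
  inv_hom_id := by
    have := s.w
    simp [reassoc_of% this]

lemma ried [HasExt.{0} C] (a b x : C) :
    Nat.card (Set.range (cls : sesSet a b x → _)) * autCard x =
      Nat.card (sesSet a b x) * homCard a b := by
  unfold autCard homCard
  rw [← Nat.card_prod]
  choose rep hrep using fun τ : Set.range (cls : sesSet a b x → _) => τ.2
  let F : Set.range (cls : sesSet a b x → _) × Aut x → sesSet a b x :=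
    fun q => (rep q.1).trans q.2
  refine card_of_fiber F fun s => ?_
  obtain ⟨l0, h1, h2⟩ := (cls_eq_iff (rep ⟨cls s, s, rfl⟩) s).1 (hrep ⟨cls s, s, rfl⟩)
  have key : ∀ h : a ⟶ b, F (⟨cls s, s, rfl⟩, l0 ≪≫ unip s h) = s := by
    intro h
    have hw := s.w
    apply Subtype.ext
    apply Prod.ext
    · change (rep ⟨cls s, s, rfl⟩).1.1 ≫ l0.hom ≫ (unip s h).hom = s.1.1
      rw [← Category.assoc, h1]
      simp [unip, reassoc_of% hw]
    · change ((unip s h).inv ≫ l0.inv) ≫ (rep ⟨cls s, s, rfl⟩).1.2 = s.1.2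
      rw [← h2]
      simp [unip, hw]
  refine ⟨(Equiv.ofBijective (fun h => ⟨(⟨cls s, s, rfl⟩, l0 ≪≫ unip s h), key h⟩) ⟨?_, ?_⟩).symm⟩
  · intro h h' e
    have e1 := congrArg (fun z => z.1.2.hom) e
    have e2 : l0.hom ≫ (unip s h).hom = l0.hom ≫ (unip s h').hom := e1
    rw [cancel_epi] at e2
    have e3 := add_left_cancel e2
    have := s.mono
    have := s.epi
    rw [cancel_epi, cancel_mono] at e3
    exact e3
  · rintro ⟨⟨τ, l⟩, hl⟩
    have hτ : τ = ⟨cls s, s, rfl⟩ := by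
      apply Subtype.ext
      rw [← hrep τ, ← cls_trans (rep τ) l]
      exact congrArg cls hl
    subst hτ
    have g1 : (rep ⟨cls s, s, rfl⟩).1.1 ≫ l.hom = s.1.1 := congrArg (fun z => z.1.1) hl
    have g2 : l.inv ≫ (rep ⟨cls s, s, rfl⟩).1.2 = s.1.2 := congrArg (fun z => z.1.2) hl
    obtain ⟨k, hk⟩ := s.desc (l0.inv ≫ l.hom - 𝟙 x) (by
      rw [Preadditive.comp_sub, Category.comp_id, ← g1, ← Category.assoc, sub_eq_zero]
      congr 1
      rw [Iso.comp_inv_eq, h1, g1])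
    have hk2 : k ≫ s.1.2 = 0 := by
      have := s.epi
      rw [← cancel_epi s.1.2, ← Category.assoc, hk, Preadditive.sub_comp, Category.assoc, ← g2,
        l.hom_inv_id_assoc, g2, (Iso.inv_comp_eq l0).2 h2.symm]
      simp
    obtain ⟨h, rfl⟩ := s.lift k hk2
    refine ⟨h, ?_⟩
    apply Subtype.ext
    refine Prod.ext rfl ?_
    apply Iso.ext
    change l0.hom ≫ (𝟙 x + s.1.2 ≫ h ≫ s.1.1) = l.hom
    rw [hk]
    simp

lemma card_sesSet (a b x : C) :
    Nat.card (sesSet a b x) = hall a b x * (autCard b * autCard a) := by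
  unfold hall autCard
  rw [← Nat.card_prod]
  let F : sesSet a b x →
    {S : Subobject x // Nonempty ((S : C) ≅ b) ∧ Nonempty ((cokernel S.arrow) ≅ a)} := fun s =>
    haveI := s.mono
    ⟨Subobject.mk s.1.1, ⟨Subobject.underlyingIso s.1.1⟩, ⟨by
      refine ?_ ≪≫ IsColimit.coconePointUniqueUpToIso (cokernelIsCokernel s.1.1) s.ses.gIsCokernel
      exact cokernel.mapIso _ _ (Subobject.underlyingIso s.1.1) (Iso.refl _) (by simp)⟩⟩
  refine card_of_fiber F fun S => ?_
  obtain ⟨S, ⟨β⟩, ⟨α⟩⟩ := S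
  let s0 : sesSet a b x := ⟨(β.inv ≫ S.arrow, cokernel.π S.arrow ≫ α.hom), by simp, by
    have h : (ShortComplex.mk S.arrow (cokernel.π S.arrow) (by simp)).ShortExact :=
      { exact := ShortComplex.exact_cokernel _ }
    refine ShortComplex.shortExact_of_iso ?_ h
    exact ShortComplex.isoMk β (Iso.refl _) α (by simp) (by simp)⟩
  have e0 := s0.epi
  have m0 := s0.mono
  let G : Aut b × Aut a → sesSet a b x := fun q => ⟨(q.1.hom ≫ s0.1.1, s0.1.2 ≫ q.2.hom),
    by have := s0.w; simp [reassoc_of% this], by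
      refine ShortComplex.shortExact_of_iso ?_ s0.ses
      exact ShortComplex.isoMk q.1.symm (Iso.refl _) q.2
        ((Iso.inv_hom_id_assoc q.1 _).trans (Category.comp_id _).symm) (Category.id_comp _)⟩
  have key : ∀ q, F (G q) = ⟨S, ⟨β⟩, ⟨α⟩⟩ := by
    intro q
    apply Subtype.ext
    have := (G q).mono
    change Subobject.mk (G q).1.1 = S
    refine (Subobject.mk_eq_mk_of_comm (G q).1.1 S.arrow (q.1 ≪≫ β.symm) ?_).trans (by simp)
    exact (Category.assoc _ _ _)
  refine ⟨(Equiv.ofBijective (fun q => ⟨G q, key q⟩) ⟨?_, ?_⟩).symm⟩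
  · intro q q' e
    have e1 : q.1.hom ≫ s0.1.1 = q'.1.hom ≫ s0.1.1 := congrArg (fun z => z.1.1.1) e
    have e2 : s0.1.2 ≫ q.2.hom = s0.1.2 ≫ q'.2.hom := congrArg (fun z => z.1.1.2) e
    rw [cancel_mono] at e1
    rw [cancel_epi] at e2
    exact Prod.ext (Iso.ext e1) (Iso.ext e2)
  · rintro ⟨s, hs⟩
    have hm := s.mono
    have hs' : Subobject.mk s.1.1 = S := congrArg Subtype.val hs
    let u : b ≅ b := (Subobject.underlyingIso s.1.1).symm ≪≫
      eqToIso (congrArg (fun S : Subobject x => (S : C)) hs') ≪≫ β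
    have hu : u.hom ≫ s0.1.1 = s.1.1 := by
      subst hs'
      simp [u, s0]
    obtain ⟨v, hv⟩ := s0.desc s.1.2 (by
      rw [← cancel_epi u.hom, ← Category.assoc, hu, s.w, comp_zero])
    obtain ⟨v', hv'⟩ := s.desc s0.1.2 (by
      rw [← hu, Category.assoc, s0.w, comp_zero])
    have he := s.epi
    let vi : a ≅ a := ⟨v, v', by
      rw [← cancel_epi s0.1.2, ← Category.assoc, hv, hv', Category.comp_id], by
      rw [← cancel_epi s.1.2, ← Category.assoc, hv', hv, Category.comp_id]⟩
    refine ⟨(u, vi), ?_⟩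
    apply Subtype.ext
    apply Subtype.ext
    exact Prod.ext hu hv

end ried

section homol
open Abelian

variable {C : Type} [SmallCategory C] [Abelian C] [HasExt.{0} C]

lemma pullSES {a b c a' : C} (i : b ⟶ c) (p : c ⟶ a) (w : i ≫ p = 0)
    (h : (ShortComplex.mk i p w).ShortExact) (α : a' ⟶ a) :
    ∃ j : b ⟶ pullback p α, j ≫ pullback.fst p α = i ∧
      ∃ w' : j ≫ pullback.snd p α = 0,
        (ShortComplex.mk j (pullback.snd p α) w').ShortExact := by
  have w0 : i ≫ p = 0 ≫ α := by rw [w, zero_comp]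
  have m1 : Mono i := h.mono_f
  have m2 : Epi p := h.epi_g
  have hm : Mono (pullback.lift i 0 w0) := mono_of_mono_fac (pullback.lift_fst _ _ _)
  refine ⟨pullback.lift i 0 w0, pullback.lift_fst _ _ _, pullback.lift_snd _ _ _, ?_⟩
  refine { exact := ?_, mono_f := hm, epi_g := ?_ }
  · refine ShortComplex.exact_of_f_is_kernel _ (KernelFork.IsLimit.ofι' _ _ fun {z} k hk => ?_)
    dsimp at k hk
    have hh := sesSet.lift (⟨(i, p), w, h⟩ : sesSet a b c) (k ≫ pullback.fst _ _) (by
      rw [Category.assoc, pullback.condition, ← Category.assoc, hk, zero_comp])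
    refine ⟨hh.choose, ?_⟩
    have h3 := hh.choose_spec
    dsimp at h3
    apply pullback.hom_ext
    · exact (Category.assoc _ _ _).trans
        ((congrArg (hh.choose ≫ ·) (pullback.lift_fst _ _ w0)).trans h3)
    · exact (Category.assoc _ _ _).trans
        ((congrArg (hh.choose ≫ ·) (pullback.lift_snd _ _ w0)).trans (comp_zero.trans hk.symm))
  · dsimp; infer_instance

lemma pushSES {a b c b' : C} (i : b ⟶ c) (p : c ⟶ a) (w : i ≫ p = 0)
    (h : (ShortComplex.mk i p w).ShortExact) (β : b ⟶ b') :
    ∃ r : pushout i β ⟶ a, pushout.inl i β ≫ r = p ∧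
      ∃ w' : pushout.inr i β ≫ r = 0,
        (ShortComplex.mk (pushout.inr i β) r w').ShortExact := by
  have w0 : i ≫ p = β ≫ 0 := by rw [w, comp_zero]
  have m1 : Mono i := h.mono_f
  have m2 : Epi p := h.epi_g
  have he : Epi (pushout.desc p 0 w0) := epi_of_epi_fac (pushout.inl_desc _ _ _)
  refine ⟨pushout.desc p 0 w0, pushout.inl_desc _ _ _, pushout.inr_desc _ _ _, ?_⟩
  refine { exact := ?_, mono_f := ?_, epi_g := he }
  · refine ShortComplex.exact_of_g_is_cokernel _
      (CokernelCofork.IsColimit.ofπ' _ _ fun {z} k hk => ?_)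
    dsimp at k hk
    have hh := sesSet.desc (⟨(i, p), w, h⟩ : sesSet a b c) (pushout.inl _ _ ≫ k) (by
      rw [← Category.assoc, pushout.condition, Category.assoc, hk, comp_zero])
    refine ⟨hh.choose, ?_⟩
    have h3 := hh.choose_spec
    dsimp at h3
    apply pushout.hom_ext
    · exact (Category.assoc _ _ _).symm.trans
        ((congrArg (· ≫ hh.choose) (pushout.inl_desc _ _ w0)).trans h3)
    · exact (Category.assoc _ _ _).symm.trans
        ((congrArg (· ≫ hh.choose) (pushout.inr_desc _ _ w0)).trans (zero_comp.trans hk.symm))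
  · dsimp; infer_instance

lemma homology_ses_raw {a b c : C} (i : b ⟶ c) (p : c ⟶ a) (w0 : i ≫ p = 0)
    (hs : (ShortComplex.mk i p w0).ShortExact)
    {a' b' c' c'' : C} (f : a' ⟶ b) (g : a ⟶ b')
    (p' : c' ⟶ a') [Epi p'] (j' : b' ⟶ c'') [Mono j'] (d0 : c' ⟶ c) (d1 : c ⟶ c'')
    (h0 : p' ≫ f ≫ i = d0) (h1 : p ≫ g ≫ j' = d1) (w : d0 ≫ d1 = 0) :
    ∃ σ : sesSet (kernel g) (cokernel f) (ShortComplex.mk d0 d1 w).homology,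
      cls σ = push (pull (kernel.ι g) (cls (⟨(i, p), w0, hs⟩ : sesSet a b c))) (cokernel.π f) := by
  obtain ⟨j, hs1, wj, hj⟩ := pullSES i p w0 hs (kernel.ι g)
  obtain ⟨r, hr, wr, hrr⟩ := pushSES _ _ wj hj (cokernel.π f)
  have i0 : pullback.fst p (kernel.ι g) ≫ d1 = 0 := by
    rw [← h1, ← Category.assoc, pullback.condition, Category.assoc, kernel.condition_assoc,
      zero_comp, comp_zero]
  let hi : IsLimit (KernelFork.ofι (pullback.fst p (kernel.ι g)) i0) :=
    KernelFork.IsLimit.ofι' _ _ fun {z} k hk =>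
      ⟨pullback.lift k (kernel.lift g (k ≫ p) (by
        rw [← cancel_mono j', zero_comp, ← hk, ← h1]; simp)) (by simp), pullback.lift_fst _ _ _⟩
  have hl : hi.lift (KernelFork.ofι d0 w) = p' ≫ f ≫ j := by
    rw [← cancel_mono (pullback.fst p (kernel.ι g))]
    refine (hi.fac (KernelFork.ofι d0 w) WalkingParallelPair.zero).trans ?_
    rw [Category.assoc, Category.assoc, hs1, h0]
    rfl
  have wπ : hi.lift (KernelFork.ofι d0 w) ≫ pushout.inl j (cokernel.π f) = 0 := by
    rw [hl, Category.assoc, Category.assoc, pushout.condition, cokernel.condition_assoc, zero_comp,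
      comp_zero]
  let h : (ShortComplex.mk d0 d1 w).LeftHomologyData :=
    { K := pullback p (kernel.ι g)
      H := pushout j (cokernel.π f)
      i := pullback.fst _ _
      π := pushout.inl _ _
      wi := i0
      hi := hi
      wπ := wπ
      hπ := CokernelCofork.IsColimit.ofπ' _ _ fun {z} k hk =>
        ⟨pushout.desc k (cokernel.desc f (j ≫ k) (by
          change hi.lift (KernelFork.ofι d0 w) ≫ k = 0 at hk
          rw [hl] at hk
          rw [← cancel_epi p', comp_zero, ← hk]; simp)) (by simp), pushout.inl_desc _ _ _⟩ }
  let s : sesSet a b c := ⟨(i, p), w0, hs⟩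
  let s1 : sesSet (kernel g) b (pullback p (kernel.ι g)) := ⟨(j, pullback.snd _ _), wj, hj⟩
  let s2 : sesSet (kernel g) (cokernel f) (pushout j (cokernel.π f)) :=
    ⟨(pushout.inr _ _, r), wr, hrr⟩
  have e1 := cls_natural s1 s (kernel.ι g) (𝟙 _) (pullback.fst p (kernel.ι g))
    (hs1.trans (Category.id_comp _).symm) pullback.condition
  have e2 := cls_natural s1 s2 (𝟙 _) (cokernel.π f) (pushout.inl j (cokernel.π f))
    pushout.condition (hr.trans (Category.comp_id _).symm)
  refine ⟨s2.trans h.homologyIso.symm, ?_⟩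
  rw [cls_trans]
  change _ = push (pull (kernel.ι g) (cls s)) _
  rw [← e1]
  simpa [push, pull] using e2.symm

lemma homology_ses {a b c : C} (s : sesSet a b c) {a' b' c' c'' : C} (f : a' ⟶ b) (g : a ⟶ b')
    (p' : c' ⟶ a') [Epi p'] (j' : b' ⟶ c'') [Mono j'] (d0 : c' ⟶ c) (d1 : c ⟶ c'')
    (h0 : p' ≫ f ≫ s.1.1 = d0) (h1 : s.1.2 ≫ g ≫ j' = d1) (w : d0 ≫ d1 = 0) :
    ∃ σ : sesSet (kernel g) (cokernel f) (ShortComplex.mk d0 d1 w).homology,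
      cls σ = push (pull (kernel.ι g) (cls s)) (cokernel.π f) := by
  obtain ⟨⟨i, p⟩, w0, hs⟩ := s
  exact homology_ses_raw i p w0 hs f g p' j' d0 d1 h0 h1 w

lemma homology_iff {a b c : C} (s : sesSet a b c) {a' b' c' c'' : C} (f : a' ⟶ b) (g : a ⟶ b')
    (p' : c' ⟶ a') [Epi p'] (j' : b' ⟶ c'') [Mono j'] (d0 : c' ⟶ c) (d1 : c ⟶ c'')
    (h0 : p' ≫ f ≫ s.1.1 = d0) (h1 : s.1.2 ≫ g ≫ j' = d1) (w : d0 ≫ d1 = 0) (x : C) :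
    Nonempty ((ShortComplex.mk d0 d1 w).homology ≅ x) ↔
      push (pull (kernel.ι g) (cls s)) (cokernel.π f) ∈
        Set.range (cls : sesSet (kernel g) (cokernel f) x → _) := by
  obtain ⟨σ, hσ⟩ := homology_ses s f g p' j' d0 d1 h0 h1 w
  constructor
  · rintro ⟨e⟩
    exact ⟨σ.trans e, by rw [cls_trans, hσ]⟩
  · rintro ⟨τ, hτ⟩
    obtain ⟨l, -, -⟩ := (cls_eq_iff σ τ).1 (hσ.trans hτ.symm)
    exact ⟨l⟩

end homol

section counting
open Abelian

lemma card_ker_mul_range {G H : Type} [AddCommGroup G] [AddCommGroup H] (f : G →+ H) :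
    Nat.card f.range * Nat.card f.ker = Nat.card G := by
  rw [AddSubgroup.card_eq_card_quotient_mul_card_addSubgroup f.ker,
    Nat.card_congr (QuotientAddGroup.quotientKerEquivRange f).toEquiv]

lemma six_term {G1 G2 G3 G4 G5 G6 : Type} [AddCommGroup G1] [AddCommGroup G2] [AddCommGroup G3]
    [AddCommGroup G4] [AddCommGroup G5] [AddCommGroup G6]
    (f1 : G1 →+ G2) (f2 : G2 →+ G3) (f3 : G3 →+ G4) (f4 : G4 →+ G5) (f5 : G5 →+ G6)
    (h1 : Function.Injective f1) (h2 : ∀ x, f2 x = 0 ↔ ∃ y, f1 y = x)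
    (h3 : ∀ x, f3 x = 0 ↔ ∃ y, f2 y = x) (h4 : ∀ x, f4 x = 0 ↔ ∃ y, f3 y = x)
    (h5 : ∀ x, f5 x = 0 ↔ ∃ y, f4 y = x) (h6 : Function.Surjective f5) :
    Nat.card G1 * Nat.card G3 * Nat.card G5 = Nat.card G2 * Nat.card G4 * Nat.card G6 := by
  have k1 : Nat.card f1.range = Nat.card G1 :=
    (Nat.card_congr (AddMonoidHom.ofInjective h1).toEquiv).symm
  have k2 : f2.ker = f1.range := by ext x; exact h2 x
  have k3 : f3.ker = f2.range := by ext x; exact h3 x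
  have k4 : f4.ker = f3.range := by ext x; exact h4 x
  have k5 : f5.ker = f4.range := by ext x; exact h5 x
  have k6 : Nat.card f5.range = Nat.card G6 := by
    rw [AddMonoidHom.range_eq_top.2 h6]
    exact Nat.card_congr AddSubgroup.topEquiv.toEquiv
  rw [← card_ker_mul_range f2, ← card_ker_mul_range f3, ← card_ker_mul_range f4,
    ← card_ker_mul_range f5, k2, k3, k4, k5, k1, k6]
  ring

lemma card_preimage {G H : Type} [AddCommGroup G] [AddCommGroup H] (f : G →+ H)
    (hf : Function.Surjective f) (T : Set H) :
    Nat.card {x | f x ∈ T} * Nat.card H = Nat.card T * Nat.card G := by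
  have h1 : Nat.card {x | f x ∈ T} = Nat.card T * Nat.card f.ker := by
    refine card_of_fiber (fun x : {x | f x ∈ T} => (⟨f x.1, x.2⟩ : T)) fun y => ?_
    obtain ⟨x0, hx0⟩ := hf y.1
    refine ⟨⟨fun x => ⟨x.1.1 - x0, ?_⟩, fun k => ⟨⟨k.1 + x0, ?_⟩, ?_⟩, ?_, ?_⟩⟩
    · have := congrArg Subtype.val x.2
      dsimp at this
      rw [AddMonoidHom.mem_ker, map_sub, this, hx0, sub_self]
    · have hk := k.2
      rw [AddMonoidHom.mem_ker] at hk
      rw [Set.mem_ofPred_eq, map_add, hk, zero_add, hx0]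
      exact y.2
    · have hk := k.2
      rw [AddMonoidHom.mem_ker] at hk
      apply Subtype.ext
      dsimp
      rw [map_add, hk, zero_add, hx0]
    · intro x; apply Subtype.ext; apply Subtype.ext; simp
    · intro x; apply Subtype.ext; simp
  have k6 : Nat.card f.range = Nat.card H := by
    rw [AddMonoidHom.range_eq_top.2 hf]
    exact Nat.card_congr AddSubgroup.topEquiv.toEquiv
  rw [h1, ← card_ker_mul_range f, k6]
  ring

variable {C : Type} [SmallCategory C] [Abelian C] [HasExt.{0} C]

lemma card_ext0 (X Y : C) : Nat.card (Ext X Y 0) = homCard X Y :=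
  Nat.card_congr Ext.addEquiv₀.toEquiv

lemma push_surj (hered : ∀ X Y : C, Subsingleton (Ext X Y 2)) {a b c : C} (s : sesSet a b c)
    (X : C) (ξ : Ext X a 1) : ∃ η : Ext X c 1, push η s.1.2 = ξ :=
  Ext.covariant_sequence_exact₃ X s.ses ξ (n₁ := 2) rfl ((hered _ _).elim _ _)

lemma pull_surj (hered : ∀ X Y : C, Subsingleton (Ext X Y 2)) {a b c : C} (s : sesSet a b c)
    (Y : C) (ξ : Ext b Y 1) : ∃ η : Ext c Y 1, pull s.1.1 η = ξ :=
  Ext.contravariant_sequence_exact₁ s.ses Y ξ (n₁ := 2) rfl ((hered _ _).elim _ _)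

lemma card_cov (hered : ∀ X Y : C, Subsingleton (Ext X Y 2)) {a b c : C} (s : sesSet a b c)
    (X : C) : homCard X b * homCard X a * ext1Card X c =
      homCard X c * ext1Card X b * ext1Card X a := by
  have hm : Mono s.1.1 := s.mono
  rw [← card_ext0, ← card_ext0, ← card_ext0]
  refine six_term ((Ext.mk₀ s.1.1).postcomp X (add_zero 0)) ((Ext.mk₀ s.1.2).postcomp X (add_zero 0))
    (s.ses.extClass.postcomp X (zero_add 1)) ((Ext.mk₀ s.1.1).postcomp X (add_zero 1))
    ((Ext.mk₀ s.1.2).postcomp X (add_zero 1)) (Ext.postcomp_mk₀_injective_of_mono X s.1.1)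
    (fun x => ⟨fun h => Ext.covariant_sequence_exact₂ X s.ses x h, ?_⟩)
    (fun x => ⟨fun h => Ext.covariant_sequence_exact₃ X s.ses x (zero_add 1) h, ?_⟩)
    (fun x => ⟨fun h => Ext.covariant_sequence_exact₁ X s.ses x h (zero_add 1), ?_⟩)
    (fun x => ⟨fun h => Ext.covariant_sequence_exact₂ X s.ses x h, ?_⟩)
    (push_surj hered s X)
  · rintro ⟨y, rfl⟩
    have := s.w
    simp [this]
  · rintro ⟨y, rfl⟩
    have := s.ses.comp_extClass
    simp
    erw [this]
    simp
  · rintro ⟨y, rfl⟩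
    have := s.ses.extClass_comp
    simp
    erw [this]
    simp
  · rintro ⟨y, rfl⟩
    have := s.w
    simp [this]

lemma card_contra (hered : ∀ X Y : C, Subsingleton (Ext X Y 2)) {a b c : C} (s : sesSet a b c)
    (Y : C) : homCard a Y * homCard b Y * ext1Card c Y =
      homCard c Y * ext1Card a Y * ext1Card b Y := by
  have hm : Epi s.1.2 := s.epi
  rw [← card_ext0, ← card_ext0, ← card_ext0]
  refine six_term ((Ext.mk₀ s.1.2).precomp Y (zero_add 0)) ((Ext.mk₀ s.1.1).precomp Y (zero_add 0))
    (s.ses.extClass.precomp Y (add_zero 1)) ((Ext.mk₀ s.1.2).precomp Y (zero_add 1))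
    ((Ext.mk₀ s.1.1).precomp Y (zero_add 1)) (Ext.precomp_mk₀_injective_of_epi Y s.1.2)
    (fun x => ⟨fun h => Ext.contravariant_sequence_exact₂ s.ses Y x h, ?_⟩)
    (fun x => ⟨fun h => Ext.contravariant_sequence_exact₁ s.ses Y x (add_zero 1) h, ?_⟩)
    (fun x => ⟨fun h => Ext.contravariant_sequence_exact₃ s.ses Y x h (add_zero 1), ?_⟩)
    (fun x => ⟨fun h => Ext.contravariant_sequence_exact₂ s.ses Y x h, ?_⟩)
    (pull_surj hered s Y)
  · rintro ⟨y, rfl⟩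
    have := s.w
    simp [this]
  · rintro ⟨y, rfl⟩
    exact s.ses.extClass_comp_assoc y (h := add_zero 1)
  · rintro ⟨y, rfl⟩
    exact s.ses.comp_extClass_assoc y (add_zero 1)
  · rintro ⟨y, rfl⟩
    have := s.w
    simp [this]

end counting

section imageses

variable {C : Type} [SmallCategory C] [Abelian C]

lemma ses_coker {a b S : C} (f : a ⟶ b) (e : Limits.image f ≅ S) :
    ∃ σ : sesSet (cokernel f) S b, σ.1.2 = cokernel.π f ∧ σ.1.1 = e.inv ≫ Limits.image.ι f := by
  have w : (e.inv ≫ Limits.image.ι f) ≫ cokernel.π f = 0 := by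
    rw [Category.assoc, ← cancel_epi e.hom, e.hom_inv_id_assoc, ← cancel_epi (Limits.factorThruImage f)]
    simp
  refine ⟨⟨(e.inv ≫ Limits.image.ι f, cokernel.π f), w, ?_⟩, rfl, rfl⟩
  refine { exact := ?_, mono_f := ?_, epi_g := ?_ }
  · refine ShortComplex.exact_of_g_is_cokernel _
      (CokernelCofork.IsColimit.ofπ' _ _ fun {z} k hk => ⟨cokernel.desc f k ?_, ?_⟩)
    · dsimp at k hk
      rw [Category.assoc, ← cancel_epi e.hom, e.hom_inv_id_assoc, comp_zero] at hk
      rw [← Limits.image.fac f, Category.assoc, hk, comp_zero]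
    · exact cokernel.π_desc _ _ _
  · dsimp; infer_instance
  · dsimp; infer_instance

lemma ses_ker {a b S : C} (f : a ⟶ b) (e : Limits.image f ≅ S) :
    ∃ σ : sesSet S (kernel f) a, σ.1.1 = kernel.ι f ∧
      σ.1.2 = Limits.factorThruImage f ≫ e.hom := by
  have w : kernel.ι f ≫ (Limits.factorThruImage f ≫ e.hom) = 0 := by
    rw [← cancel_mono e.inv, ← cancel_mono (Limits.image.ι f)]; simp
  refine ⟨⟨(kernel.ι f, Limits.factorThruImage f ≫ e.hom), w, ?_⟩, rfl, rfl⟩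
  refine { exact := ?_, mono_f := ?_, epi_g := ?_ }
  · refine ShortComplex.exact_of_f_is_kernel _
      (KernelFork.IsLimit.ofι' _ _ fun {z} k hk => ⟨kernel.lift f k ?_, ?_⟩)
    · dsimp at k hk
      rw [← Category.assoc, ← cancel_mono e.inv, Category.assoc, e.hom_inv_id, Category.comp_id,
        zero_comp] at hk
      rw [← Limits.image.fac f, ← Category.assoc, hk, zero_comp]
    · exact kernel.lift_ι _ _ _
  · dsimp; infer_instance
  · dsimp; infer_instance

end imageses

section counting2
open Abelian

variable {C : Type} [SmallCategory C] [Abelian C] [HasExt.{0} C]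

/-- the basic count -/
lemma local_count (hfinHom : ∀ X Y : C, Finite (X ⟶ Y)) (hfinExt : ∀ X Y : C, Finite (Ext X Y 1))
    (hered : ∀ X Y : C, Subsingleton (Ext X Y 2)) {a b K Q S S' : C}
    (σ : sesSet Q S b) (τ : sesSet S' K a) (x : C) :
    (Nat.card {ξ : Ext a b 1 | push (pull τ.1.1 ξ) σ.1.2 ∈
        Set.range (cls : sesSet K Q x → _)} : ℚ) =
      (hall K Q x : ℚ) * (autCard K : ℚ) * (autCard Q : ℚ) * (homCard a b : ℚ) /
        ((autCard x : ℚ) * euler a S * euler S' Q) := by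
  have posH : ∀ X Y : C, (homCard X Y : ℚ) ≠ 0 := fun X Y => by
    have := hfinHom X Y
    have : Nonempty (X ⟶ Y) := ⟨0⟩
    exact_mod_cast Nat.card_pos.ne'
  have posE : ∀ X Y : C, (ext1Card X Y : ℚ) ≠ 0 := fun X Y => by
    have := hfinExt X Y
    exact_mod_cast (Nat.card_pos (α := Ext X Y 1)).ne'
  have posA : (autCard x : ℚ) ≠ 0 := by
    have := hfinHom x x
    have : Finite (Aut x) := Finite.of_injective (fun e : Aut x => (Iso.hom e : x ⟶ x)) (by
      intro e e' h; exact Iso.ext h)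
    exact_mod_cast (Nat.card_pos (α := Aut x)).ne'
  let F : Ext a b 1 →+ Ext K Q 1 :=
    ((Ext.mk₀ σ.1.2).postcomp K (add_zero 1)).comp ((Ext.mk₀ τ.1.1).precomp b (zero_add 1))
  have hF : Function.Surjective F := by
    intro y
    obtain ⟨z, hz⟩ := push_surj hered σ K y
    obtain ⟨u, hu⟩ := pull_surj hered τ b z
    refine ⟨u, ?_⟩
    change push (pull τ.1.1 u) σ.1.2 = y
    rw [hu, hz]
  have h1 := card_preimage F hF (Set.range (cls : sesSet K Q x → _))
  have h2 := ried K Q x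
  rw [card_sesSet] at h2
  have h3 := card_cov hered σ a
  have h4 := card_contra hered τ Q
  change Nat.card {ξ : Ext a b 1 | push (pull τ.1.1 ξ) σ.1.2 ∈
        Set.range (cls : sesSet K Q x → _)} * ext1Card K Q = _ * ext1Card a b at h1
  have h1' := congrArg (Nat.cast : ℕ → ℚ) h1
  have h2' := congrArg (Nat.cast : ℕ → ℚ) h2
  have h3' := congrArg (Nat.cast : ℕ → ℚ) h3
  have h4' := congrArg (Nat.cast : ℕ → ℚ) h4
  push_cast at h1' h2' h3' h4'
  generalize (Nat.card {ξ : Ext a b 1 | push (pull τ.1.1 ξ) σ.1.2 ∈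
        Set.range (cls : sesSet K Q x → _)} : ℚ) = cnt at *
  generalize (Nat.card (Set.range (cls : sesSet K Q x → _)) : ℚ) = R at *
  unfold euler
  have n1 := posH a S
  have n2 := posH a Q
  have n3 := posH a b
  have n4 := posH S' Q
  have n5 := posH K Q
  have e1 := posE a S
  have e2 := posE a Q
  have e3 := posE a b
  have e4 := posE S' Q
  have e5 := posE K Q
  have hR : R = (hall K Q x : ℚ) * (autCard Q * autCard K) * homCard K Q / autCard x := by
    rw [eq_div_iff posA]; exact h2'
  have hc : cnt = R * ext1Card a b / ext1Card K Q := by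
    rw [eq_div_iff e5]; exact h1'
  have hE : (ext1Card a b : ℚ) = homCard a b * ext1Card a S * ext1Card a Q /
      (homCard a S * homCard a Q) := by
    rw [eq_div_iff (mul_ne_zero n1 n2)]; linarith
  have hE2 : (ext1Card a Q : ℚ) = homCard a Q * ext1Card S' Q * ext1Card K Q /
      (homCard S' Q * homCard K Q) := by
    rw [eq_div_iff (mul_ne_zero n4 n5)]; linarith
  rw [hc, hR, hE, hE2]
  field_simp

end counting2

section fcount
open Abelian

variable {C : Type} [SmallCategory C] [Abelian C]

/-- transport along isomorphisms of the ends -/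
def sesSet.ends {a b c a' b' : C} (s : sesSet a b c) (α : a ≅ a') (β : b ≅ b') : sesSet a' b' c :=
  ⟨(β.inv ≫ s.1.1, s.1.2 ≫ α.hom), by have := s.w; simp [reassoc_of% this], by
      refine ShortComplex.shortExact_of_iso ?_ s.ses
      exact ShortComplex.isoMk β (Iso.refl _) α
        ((Iso.hom_inv_id_assoc β _).trans (Category.comp_id _).symm) (Category.id_comp _)⟩

lemma liftIso {a b c a' b' : C} (s : sesSet a b c) (s' : sesSet a' b' c)
    (h : s.1.1 ≫ s'.1.2 = 0) (h' : s'.1.1 ≫ s.1.2 = 0) :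
    ∃ u : b ≅ b', u.hom ≫ s'.1.1 = s.1.1 := by
  obtain ⟨u, hu⟩ := s'.lift _ h
  obtain ⟨v, hv⟩ := s.lift _ h'
  have m1 := s.mono
  have m2 := s'.mono
  exact ⟨⟨u, v, by rw [← cancel_mono s.1.1, Category.assoc, hv, hu, Category.id_comp],
    by rw [← cancel_mono s'.1.1, Category.assoc, hu, hv, Category.id_comp]⟩, hu⟩

lemma descIso {a b c a' b' : C} (s : sesSet a b c) (s' : sesSet a' b' c)
    (h : s.1.1 ≫ s'.1.2 = 0) (h' : s'.1.1 ≫ s.1.2 = 0) :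
    ∃ u : a ≅ a', s.1.2 ≫ u.hom = s'.1.2 := by
  obtain ⟨u, hu⟩ := s.desc _ h
  obtain ⟨v, hv⟩ := s'.desc _ h'
  have m1 := s.epi
  have m2 := s'.epi
  exact ⟨⟨u, v, by rw [← cancel_epi s.1.2, ← Category.assoc, hu, hv, Category.comp_id],
    by rw [← cancel_epi s'.1.2, ← Category.assoc, hv, hu, Category.comp_id]⟩, hu⟩

/-- morphisms with prescribed image, kernel and cokernel -/
def homType (a b S M N : C) : Type :=
  {f : a ⟶ b // Nonempty (Limits.image f ≅ S) ∧ Nonempty (kernel f ≅ M) ∧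
    Nonempty (cokernel f ≅ N)}

lemma homType_aux {a b S M N : C} (σ : sesSet S M a) (τ : sesSet N S b) :
    Nonempty (Limits.image (σ.1.2 ≫ τ.1.1) ≅ S) ∧ Nonempty (kernel (σ.1.2 ≫ τ.1.1) ≅ M) ∧
      Nonempty (cokernel (σ.1.2 ≫ τ.1.1) ≅ N) := by
  have := σ.epi
  have := τ.mono
  have : StrongEpi σ.1.2 := strongEpi_of_epi _
  refine ⟨⟨(image.isoStrongEpiMono σ.1.2 τ.1.1 rfl).symm⟩, ⟨kernelCompMono σ.1.2 τ.1.1 ≪≫ ?_⟩,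
    ⟨cokernelEpiComp σ.1.2 τ.1.1 ≪≫ ?_⟩⟩
  · exact IsLimit.conePointUniqueUpToIso (kernelIsKernel σ.1.2) σ.ses.fIsKernel
  · exact IsColimit.coconePointUniqueUpToIso (cokernelIsCokernel τ.1.1) τ.ses.gIsCokernel

lemma homType_card (hfinHom : ∀ X Y : C, Finite (X ⟶ Y)) (a b S M N : C) :
    Nat.card (homType a b S M N) = hall S M a * autCard S * hall N S b := by
  have hA : ∀ x : C, 0 < autCard x := fun x => by
    have := hfinHom x x
    have : Finite (Aut x) := Finite.of_injective (fun e : Aut x => (Iso.hom e : x ⟶ x)) (by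
      intro e e' h; exact Iso.ext h)
    exact (Nat.card_pos (α := Aut x))
  let F : sesSet S M a × sesSet N S b → homType a b S M N := fun q =>
    ⟨q.1.1.2 ≫ q.2.1.1, homType_aux q.1 q.2⟩
  have key : Nat.card (sesSet S M a × sesSet N S b) = Nat.card (homType a b S M N) *
      Nat.card (Aut M × Aut S × Aut N) := by
    refine card_of_fiber F fun f => ?_
    obtain ⟨f, ⟨eS⟩, ⟨eM⟩, ⟨eN⟩⟩ := f
    obtain ⟨σ', h1, h2⟩ := ses_ker f eS
    obtain ⟨τ', h3, h4⟩ := ses_coker f eS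
    obtain ⟨σ, τ, hf⟩ : ∃ (σ : sesSet S M a) (τ : sesSet N S b), σ.1.2 ≫ τ.1.1 = f := by
      refine ⟨σ'.ends (Iso.refl _) eM, τ'.ends eN (Iso.refl _), ?_⟩
      change (σ'.1.2 ≫ 𝟙 _) ≫ (𝟙 _ ≫ τ'.1.1) = f
      rw [h2, h4, Category.comp_id, Category.id_comp]
      simp
    clear h1 h2 h3 h4 τ' σ'
    have g1 := σ.mono
    have g2 := σ.epi
    have g3 := τ.mono
    have g4 := τ.epi
    let G : Aut M × Aut S × Aut N → sesSet S M a × sesSet N S b := fun q =>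
      (σ.ends q.2.1 q.1, τ.ends q.2.2 q.2.1)
    have hG : ∀ q, F (G q) = ⟨f, ⟨eS⟩, ⟨eM⟩, ⟨eN⟩⟩ := by
      intro q
      apply Subtype.ext
      change (σ.1.2 ≫ q.2.1.hom) ≫ (q.2.1.inv ≫ τ.1.1) = f
      rw [← hf, Category.assoc]
      exact congrArg (σ.1.2 ≫ ·) (Iso.hom_inv_id_assoc q.2.1 _)
    refine ⟨(Equiv.ofBijective (fun q => ⟨G q, hG q⟩) ⟨?_, ?_⟩).symm⟩
    · intro q q' e
      have e1 : q.1.inv ≫ σ.1.1 = q'.1.inv ≫ σ.1.1 := congrArg (fun z => z.1.1.1.1) e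
      have e2 : σ.1.2 ≫ q.2.1.hom = σ.1.2 ≫ q'.2.1.hom := congrArg (fun z => z.1.1.1.2) e
      have e3 : τ.1.2 ≫ q.2.2.hom = τ.1.2 ≫ q'.2.2.hom := congrArg (fun z => z.1.2.1.2) e
      rw [cancel_mono] at e1
      rw [cancel_epi] at e2 e3
      refine Prod.ext ?_ (Prod.ext (Iso.ext e2) (Iso.ext e3))
      exact Iso.symm_eq_iff.1 (Iso.ext e1 : q.1.symm = q'.1.symm)
    · rintro ⟨⟨σ', τ'⟩, hs⟩
      have hs' : σ'.1.2 ≫ τ'.1.1 = f := congrArg Subtype.val hs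
      have g1' := σ'.mono
      have g2' := σ'.epi
      have g3' := τ'.mono
      have g4' := τ'.epi
      have k1 : σ.1.1 ≫ σ'.1.2 = 0 := by
        rw [← cancel_mono τ'.1.1, zero_comp, Category.assoc, hs', ← hf, ← Category.assoc, σ.w,
          zero_comp]
      have k2 : σ'.1.1 ≫ σ.1.2 = 0 := by
        rw [← cancel_mono τ.1.1, zero_comp, Category.assoc, hf, ← hs', ← Category.assoc, σ'.w,
          zero_comp]
      have k3 : τ.1.1 ≫ τ'.1.2 = 0 := by
        rw [← cancel_epi σ.1.2, comp_zero, ← Category.assoc, hf, ← hs', Category.assoc, τ'.w,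
          comp_zero]
      have k4 : τ'.1.1 ≫ τ.1.2 = 0 := by
        rw [← cancel_epi σ'.1.2, comp_zero, ← Category.assoc, hs', ← hf, Category.assoc, τ.w,
          comp_zero]
      obtain ⟨v, hv⟩ := descIso σ σ' k1 k2
      obtain ⟨u, hu⟩ := liftIso σ' σ k2 k1
      obtain ⟨w, hw⟩ := descIso τ τ' k3 k4
      have hv' : v.inv ≫ τ.1.1 = τ'.1.1 := by
        rw [← cancel_epi v.hom, Iso.hom_inv_id_assoc, ← cancel_epi σ.1.2, hf, ← Category.assoc, hv,
          hs']
      refine ⟨(u.symm, v, w), ?_⟩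
      apply Subtype.ext
      refine Prod.ext (Subtype.ext (Prod.ext hu hv)) (Subtype.ext (Prod.ext hv' hw))
  rw [Nat.card_prod, Nat.card_prod, Nat.card_prod, card_sesSet, card_sesSet] at key
  change _ = _ * (autCard M * (autCard S * autCard N)) at key
  have hpos : 0 < autCard M * (autCard S * autCard N) :=
    Nat.mul_pos (hA M) (Nat.mul_pos (hA S) (hA N))
  refine Nat.eq_of_mul_eq_mul_right hpos ?_
  rw [← key]
  ring

lemma autCard_congr {a b : C} (e : a ≅ b) : autCard a = autCard b :=
  Nat.card_congr (e.conjAut).toEquiv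

lemma hall_congr {a a' b b' c : C} (e : a ≅ a') (e' : b ≅ b') : hall a b c = hall a' b' c := by
  unfold hall
  refine Nat.card_congr (Equiv.subtypeEquivRight fun S => ?_)
  exact and_congr ⟨fun ⟨h⟩ => ⟨h ≪≫ e'⟩, fun ⟨h⟩ => ⟨h ≪≫ e'.symm⟩⟩
    ⟨fun ⟨h⟩ => ⟨h ≪≫ e⟩, fun ⟨h⟩ => ⟨h ≪≫ e.symm⟩⟩

lemma euler_congr [HasExt.{0} C] {a b b' : C} (e : b ≅ b') : euler a b = euler a b' := by
  unfold euler
  have h1 : homCard a b = homCard a b' := Nat.card_congr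
    ⟨fun f => f ≫ e.hom, fun f => f ≫ e.inv, fun f => by simp, fun f => by simp⟩
  have h2 : ext1Card a b = ext1Card a b' := Nat.card_congr
    ⟨fun f => push f e.hom, fun f => push f e.inv, fun f => by simp [push], fun f => by simp [push]⟩
  rw [h1, h2]

end fcount

section cplx
open Abelian

variable {C : Type} [SmallCategory C] [Abelian C] {t : ℕ}

lemma pShape_rel (i j : ZMod t) : (pShape t).Rel i j ↔ i + 1 = j := Iff.rfl

/-- the component in degree `i` of a short exact sequence of complexes -/
def deg {A1 A2 : ZMod t → C} {E : Ct C t} (s : sesSet (mkZero A1) (mkZero A2) E) (i : ZMod t) :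
    sesSet (A1 i) (A2 i) (E.X i) :=
  ⟨(s.1.1.f i, s.1.2.f i), by
    obtain ⟨w, h⟩ := s.2
    exact ⟨congrArg (fun g => HomologicalComplex.Hom.f g i) w,
      h.map_of_exact (HomologicalComplex.eval C (pShape t) i)⟩⟩

lemma deg_comm1 {A1 A2 : ZMod t → C} {E : Ct C t} (s : sesSet (mkZero A1) (mkZero A2) E)
    (i j : ZMod t) : (deg s i).1.1 ≫ E.d i j = 0 :=
  (s.1.1.comm i j).trans zero_comp

lemma deg_comm2 {A1 A2 : ZMod t → C} {E : Ct C t} (s : sesSet (mkZero A1) (mkZero A2) E)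
    (i j : ZMod t) : E.d i j ≫ (deg s j).1.2 = 0 :=
  (s.1.2.comm i j).symm.trans comp_zero

lemma exists_fm {A1 A2 : ZMod t → C} {E : Ct C t} (s : sesSet (mkZero A1) (mkZero A2) E)
    (i : ZMod t) : ∃ f : A1 i ⟶ A2 (i + 1),
      (deg s i).1.2 ≫ f ≫ (deg s (i + 1)).1.1 = E.d i (i + 1) := by
  obtain ⟨g, hg⟩ := (deg s i).desc _ (deg_comm1 s i (i + 1))
  have := (deg s i).epi
  obtain ⟨f, hf⟩ := (deg s (i + 1)).lift g (by
    rw [← cancel_epi (deg s i).1.2, ← Category.assoc, hg, deg_comm2, comp_zero])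
  exact ⟨f, by rw [hf, hg]⟩

/-- the morphism determining the differential -/
def fm {A1 A2 : ZMod t → C} {E : Ct C t} (s : sesSet (mkZero A1) (mkZero A2) E)
    (i : ZMod t) : A1 i ⟶ A2 (i + 1) := (exists_fm s i).choose

lemma fm_spec {A1 A2 : ZMod t → C} {E : Ct C t} (s : sesSet (mkZero A1) (mkZero A2) E)
    (i : ZMod t) : (deg s i).1.2 ≫ fm s i ≫ (deg s (i + 1)).1.1 = E.d i (i + 1) :=
  (exists_fm s i).choose_spec

lemma fm_unique {A1 A2 : ZMod t → C} {E : Ct C t} (s : sesSet (mkZero A1) (mkZero A2) E)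
    (i : ZMod t) (f : A1 i ⟶ A2 (i + 1))
    (h : (deg s i).1.2 ≫ f ≫ (deg s (i + 1)).1.1 = E.d i (i + 1)) : fm s i = f := by
  have := (deg s i).epi
  have := (deg s (i + 1)).mono
  rw [← fm_spec s i] at h
  rw [cancel_epi, cancel_mono] at h
  exact h.symm

lemma image_iff {a b c d : C} (p : c ⟶ a) [Epi p] (f : a ⟶ b) (j : b ⟶ d) [Mono j]
    (e : c ⟶ d) (h : p ≫ f ≫ j = e) (S : C) :
    Nonempty (Limits.image e ≅ S) ↔ Nonempty (Limits.image f ≅ S) := by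
  have : StrongEpi (p ≫ Limits.factorThruImage f) := strongEpi_of_epi _
  have i0 : Limits.image f ≅ Limits.image e :=
    image.isoStrongEpiMono (p ≫ Limits.factorThruImage f) (Limits.image.ι f ≫ j) (by rw [← h]; simp)
  exact ⟨fun ⟨x⟩ => ⟨i0 ≪≫ x⟩, fun ⟨x⟩ => ⟨i0.symm ≪≫ x⟩⟩

variable [HasExt.{0} C]

lemma homology_deg_iff {A1 A2 : ZMod t → C} {E : Ct C t} (s : sesSet (mkZero A1) (mkZero A2) E)
    (i : ZMod t) (x : C) :
    Nonempty (E.homology (i + 1) ≅ x) ↔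
      push (pull (kernel.ι (fm s (i + 1))) (cls (deg s (i + 1)))) (cokernel.π (fm s i)) ∈
        Set.range (cls : sesSet (kernel (fm s (i + 1))) (cokernel (fm s i)) x → _) := by
  have := (deg s i).epi
  have := (deg s (i + 1 + 1)).mono
  rw [← homology_iff (deg s (i + 1)) (fm s i) (fm s (i + 1)) (deg s i).1.2
    (deg s (i + 1 + 1)).1.1 (E.d i (i + 1)) (E.d (i + 1) (i + 1 + 1)) (fm_spec s i)
    (fm_spec s (i + 1)) (E.d_comp_d _ _ _)]
  have e : E.homology (i + 1) ≅ (E.sc' i (i + 1) (i + 1 + 1)).homology :=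
    ShortComplex.homologyMapIso (E.isoSc' i (i + 1) (i + 1 + 1)
      ((pShape t).prev_eq' rfl) ((pShape t).next_eq' rfl))
  exact ⟨fun ⟨x⟩ => ⟨e.symm ≪≫ x⟩, fun ⟨x⟩ => ⟨e ≪≫ x⟩⟩

/-- The parameters of an extension of complexes with zero differential. -/
abbrev Par0 (A1 A2 : ZMod t → C) : Type :=
  (∀ i, Ext (A1 i) (A2 i) 1) × (∀ i, A1 i ⟶ A2 (i + 1))

def par {A1 A2 : ZMod t → C} {E : Ct C t} (s : sesSet (mkZero A1) (mkZero A2) E) : Par0 A1 A2 :=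
  (fun i => cls (deg s i), fun i => fm s i)

lemma par_eq_iff {A1 A2 : ZMod t → C} {E E' : Ct C t} (s : sesSet (mkZero A1) (mkZero A2) E)
    (s' : sesSet (mkZero A1) (mkZero A2) E') :
    par s = par s' ↔ ∃ l : E ≅ E', s.1.1 ≫ l.hom = s'.1.1 ∧ l.hom ≫ s'.1.2 = s.1.2 := by
  constructor
  · intro h
    have h1 : ∀ i, cls (deg s i) = cls (deg s' i) := fun i => congrFun (congrArg Prod.fst h) i
    have h2 : ∀ i, fm s i = fm s' i := fun i => congrFun (congrArg Prod.snd h) i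
    choose l hl1 hl2 using fun i => (cls_eq_iff _ _).1 (h1 i)
    refine ⟨HomologicalComplex.Hom.isoOfComponents l ?_, ?_, ?_⟩
    · intro i j hij
      obtain rfl : i + 1 = j := hij
      rw [← fm_spec s, ← fm_spec s', ← Category.assoc, hl2, h2 i, Category.assoc, Category.assoc,
        hl1]
    · ext i
      exact hl1 i
    · ext i
      exact hl2 i
  · rintro ⟨l, h1, h2⟩
    have g1 : ∀ i, (deg s i).1.1 ≫ l.hom.f i = (deg s' i).1.1 := fun i =>
      congrArg (fun g => HomologicalComplex.Hom.f g i) h1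
    have g2 : ∀ i, l.hom.f i ≫ (deg s' i).1.2 = (deg s i).1.2 := fun i =>
      congrArg (fun g => HomologicalComplex.Hom.f g i) h2
    refine Prod.ext (funext fun i => ?_) (funext fun i => ?_)
    · exact (cls_eq_iff _ _).2 ⟨(HomologicalComplex.eval C (pShape t) i).mapIso l, g1 i, g2 i⟩
    · refine fm_unique s i _ ?_
      have hm : Mono (l.hom.f (i + 1)) :=
        inferInstanceAs (Mono ((HomologicalComplex.eval C (pShape t) (i + 1)).map l.hom))
      rw [← cancel_mono (l.hom.f (i + 1)), Category.assoc, Category.assoc, g1, ← g2 i,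
        Category.assoc]
      change l.hom.f i ≫ (deg s' i).1.2 ≫ fm s' i ≫ _ = _
      rw [fm_spec s' i]
      exact l.hom.comm _ _

lemma par_surj {A1 A2 : ZMod t → C} (q : Par0 A1 A2) :
    ∃ (E : Ct C t) (s : sesSet (mkZero A1) (mkZero A2) E), par s = q := by
  obtain ⟨ξ, f⟩ := q
  choose c s hs using fun i => exists_cls (ξ i)
  let E : Ct C t :=
    { X := c
      d := fun i j => if h : i + 1 = j then
        (s i).1.2 ≫ f i ≫ (s (i + 1)).1.1 ≫ eqToHom (congrArg c h) else 0
      shape := fun i j h => dif_neg h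
      d_comp_d' := fun i j k hij hjk => by
        obtain rfl : i + 1 = j := hij
        obtain rfl : i + 1 + 1 = k := hjk
        have := (s (i + 1)).w
        simp [reassoc_of% this] }
  have hd : ∀ i, E.d i (i + 1) = (s i).1.2 ≫ f i ≫ (s (i + 1)).1.1 := fun i =>
    (dif_pos rfl).trans (by simp)
  let φ : mkZero A2 ⟶ E :=
    { f := fun i => (s i).1.1
      comm' := fun i j hij => by
        obtain rfl : i + 1 = j := hij
        rw [hd]
        have := (s i).w
        refine ((Category.assoc _ _ _).symm.trans ?_).trans zero_comp.symm
        exact (congrArg (· ≫ _) this).trans zero_comp }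
  let ψ : E ⟶ mkZero A1 :=
    { f := fun i => (s i).1.2
      comm' := fun i j hij => by
        obtain rfl : i + 1 = j := hij
        have h0 : ((s i).1.2 ≫ f i ≫ (s (i + 1)).1.1) ≫ (s (i + 1)).1.2 = 0 := by
          rw [Category.assoc, Category.assoc, (s (i + 1)).w, comp_zero, comp_zero]
        rw [hd]
        exact comp_zero.trans h0.symm }
  have w : φ ≫ ψ = 0 := by
    ext i
    exact (s i).w
  refine ⟨E, ⟨(φ, ψ), w, ?_⟩, ?_⟩
  · exact HomologicalComplex.shortExact_of_degreewise_shortExact _ fun i => (s i).ses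
  · refine Prod.ext (funext fun i => hs i) (funext fun i => fm_unique _ i _ (hd i).symm)

end cplx

section epscount
open Abelian

variable {C : Type} [SmallCategory C] [Abelian C] {t : ℕ} [HasExt.{0} C]

/-- The conditions on the parameters cutting out `eps`. -/
def ParCond {A1 A2 : ZMod t → C} (X S : ZMod t → C) (q : Par0 A1 A2) : Prop :=
  (∀ i, push (pull (kernel.ι (q.2 (i + 1))) (q.1 (i + 1))) (cokernel.π (q.2 i)) ∈
    Set.range (cls : sesSet (kernel (q.2 (i + 1))) (cokernel (q.2 i)) (X (i + 1)) → _)) ∧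
  ∀ i, Nonempty (Limits.image (q.2 i) ≅ S (i + 1))

lemma parCond_iff {A1 A2 : ZMod t → C} (X S : ZMod t → C) {E : Ct C t}
    (s : sesSet (mkZero A1) (mkZero A2) E) :
    ((∀ i : ZMod t, Nonempty (E.homology i ≅ X i)) ∧
      (∀ i : ZMod t, Nonempty (Limits.image (E.d i (i + 1)) ≅ S (i + 1)))) ↔
    ParCond X S (par s) := by
  refine and_congr ⟨fun h i => (homology_deg_iff s i _).1 (h (i + 1)), fun h i => ?_⟩
    (forall_congr' fun i => ?_)
  · have := (homology_deg_iff s (i - 1) _).2 (h (i - 1))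
    rwa [sub_add_cancel] at this
  · have := (deg s i).epi
    have := (deg s (i + 1)).mono
    exact image_iff (deg s i).1.2 (fm s i) (deg s (i + 1)).1.1 _ (fm_spec s i) _

lemma card_of_ker {T P Q : Type*} (f : T → P) (g : T → Q) (hf : Function.Surjective f)
    (hg : Function.Surjective g) (h : ∀ x y, f x = f y ↔ g x = g y) : Nonempty (P ≃ Q) := by
  have e : Setoid.ker f = Setoid.ker g := Setoid.ext fun x y => h x y
  exact ⟨(Setoid.quotientKerEquivOfSurjective f hf).symm.trans
    ((Quotient.congrRight fun x y => h x y).trans (Setoid.quotientKerEquivOfSurjective g hg))⟩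

lemma eps_card (A1 A2 X S : ZMod t → C) :
    Nat.card (eps A1 A2 X S) = Nat.card {q : Par0 A1 A2 // ParCond X S q} := by
  let T := Σ c : epsIdx X S, sesSet (mkZero A1) (mkZero A2) c.1.out
  let F : T → eps A1 A2 X S := fun z => ⟨z.1, Quot.mk _ z.2⟩
  let G : T → {q : Par0 A1 A2 // ParCond X S q} := fun z =>
    ⟨par z.2, (parCond_iff X S z.2).1 z.1.2⟩
  refine Nat.card_congr (card_of_ker F G ?_ ?_ ?_).some
  · rintro ⟨c, s⟩
    obtain ⟨s, rfl⟩ := Quot.exists_rep s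
    exact ⟨⟨c, s⟩, rfl⟩
  · rintro ⟨q, hq⟩
    obtain ⟨E, s, rfl⟩ := par_surj q
    let c : IsoCl (Ct C t) := Quotient.mk (isIsomorphicSetoid (Ct C t)) E
    obtain ⟨e⟩ : Nonempty (E ≅ c.out) :=
      ⟨(Quotient.mk_out (s := isIsomorphicSetoid (Ct C t)) E).some.symm⟩
    have hp : par (s.trans e) = par s := ((par_eq_iff s (s.trans e)).2 ⟨e, rfl, by
      simp [sesSet.trans]⟩).symm
    have hc : ParCond X S (par (s.trans e)) := hp ▸ hq
    refine ⟨⟨⟨c, (parCond_iff X S (s.trans e)).2 hc⟩, s.trans e⟩, ?_⟩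
    exact Subtype.ext hp
  · rintro ⟨⟨c, hc⟩, s⟩ ⟨⟨c', hc'⟩, s'⟩
    constructor
    · intro h
      obtain ⟨h1, h2⟩ := Sigma.mk.inj h
      obtain rfl : c = c' := congrArg Subtype.val h1
      exact Subtype.ext (congrArg (Quot.lift (fun x : sesSet (mkZero A1) (mkZero A2) c.out => par x)
        (fun x y h => (par_eq_iff x y).2 h)) (eq_of_heq h2))
    · intro h
      have h1 : par s = par s' := congrArg Subtype.val h
      obtain ⟨l, hl⟩ := (par_eq_iff _ _).1 h1
      obtain rfl : c = c' := Quotient.out_equiv_out.1 ⟨l⟩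
      have : (Quot.mk _ s : extWithMiddle (mkZero A1) (mkZero A2) c.out) = Quot.mk _ s' :=
        Quot.sound ⟨l, hl⟩
      change (⟨⟨c, hc⟩, Quot.mk _ s⟩ : eps A1 A2 X S) = ⟨⟨c, hc'⟩, Quot.mk _ s'⟩
      rw [this]

end epscount

section final
open Abelian

lemma sum_fiber {H P : Type} [Fintype H] (κ : H → P) (V : P → ℚ) :
    (Function.support fun p => (Nat.card {f // κ f = p} : ℚ) * V p).Finite ∧
    ∑ f, V (κ f) = ∑ᶠ p, (Nat.card {f // κ f = p} : ℚ) * V p := by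
  classical
  have hsub : (Function.support fun p => (Nat.card {f // κ f = p} : ℚ) * V p) ⊆
      ((Finset.univ.image κ : Finset P) : Set P) := by
    intro p hp
    by_contra hn
    apply hp
    have : IsEmpty {f // κ f = p} := ⟨fun f => hn (by simpa using ⟨f.1, f.2⟩)⟩
    simp
  refine ⟨(Finset.finite_toSet _).subset hsub, ?_⟩
  rw [finsum_eq_sum_of_support_subset _ hsub, Finset.sum_comp V κ]
  refine Finset.sum_congr rfl fun p _ => ?_
  rw [nsmul_eq_mul, Nat.card_eq_fintype_card, Fintype.card_subtype]

variable {C : Type} [SmallCategory C] [Abelian C] {t : ℕ}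

def isoMk (a : C) : IsoCl C := Quotient.mk (isIsomorphicSetoid C) a

lemma isoMk_eq_iff (a : C) (q : IsoCl C) : isoMk a = q ↔ Nonempty (a ≅ q.out) := by
  constructor
  · rintro rfl
    exact ⟨(Quotient.mk_out (s := isIsomorphicSetoid C) a).some.symm⟩
  · intro h
    have : isoMk a = isoMk q.out := Quotient.sound (s := isIsomorphicSetoid C) h
    exact this.trans (Quotient.out_eq q)

/-- families of morphisms with prescribed images -/
abbrev HFam (A1 A2 S : ZMod t → C) : Type :=
  ∀ i : ZMod t, {g : A1 i ⟶ A2 (i + 1) // Nonempty (Limits.image g ≅ S (i + 1))}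

def kap {A1 A2 S : ZMod t → C} (f : HFam A1 A2 S) :
    (ZMod t → IsoCl C) × (ZMod t → IsoCl C) :=
  (fun j => isoMk (kernel (f j).1), fun j => isoMk (cokernel (f (j - 1)).1))

lemma kap_eq_iff {A1 A2 S : ZMod t → C} (f : HFam A1 A2 S)
    (M N : ZMod t → IsoCl C) : kap f = (M, N) ↔
      ∀ i, Nonempty (kernel (f i).1 ≅ (M i).out) ∧ Nonempty (cokernel (f i).1 ≅ (N (i + 1)).out) := by
  rw [Prod.ext_iff, funext_iff, funext_iff, forall_and]
  refine and_congr (forall_congr' fun i => isoMk_eq_iff _ _) ⟨fun h i => ?_, fun h j => ?_⟩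
  · rw [← isoMk_eq_iff]
    have hi : isoMk (cokernel (f (i + 1 - 1)).1) = N (i + 1) := h (i + 1)
    rw [← hi, add_sub_cancel_right]
  · have := h (j - 1)
    rw [← isoMk_eq_iff] at this
    exact this.trans (congrArg N (sub_add_cancel j 1))

lemma fiber_card [NeZero t] (hfinHom : ∀ X Y : C, Finite (X ⟶ Y)) (A1 A2 S : ZMod t → C)
    (M N : ZMod t → IsoCl C) :
    Nat.card {f : HFam A1 A2 S // kap f = (M, N)} =
      ∏ i : ZMod t, hall (S (i + 1)) (M i).out (A1 i) *
        (autCard (S i) * hall (N i).out (S i) (A2 i)) := by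
  have e1 : {f : HFam A1 A2 S // kap f = (M, N)} ≃
      ∀ i, homType (A1 i) (A2 (i + 1)) (S (i + 1)) (M i).out (N (i + 1)).out :=
    (Equiv.subtypeEquivRight fun f => kap_eq_iff f M N).trans
      ((Equiv.subtypePiEquivPi
        (p := fun i (g : {g : A1 i ⟶ A2 (i + 1) // Nonempty (Limits.image g ≅ S (i + 1))}) =>
          Nonempty (kernel g.1 ≅ (M i).out) ∧ Nonempty (cokernel g.1 ≅ (N (i + 1)).out))).trans
      (Equiv.piCongrRight fun i => Equiv.subtypeSubtypeEquivSubtypeInter _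
        (fun g : A1 i ⟶ A2 (i + 1) =>
          Nonempty (kernel g ≅ (M i).out) ∧ Nonempty (cokernel g ≅ (N (i + 1)).out))))
  rw [Nat.card_congr e1, Nat.card_pi, Finset.prod_mul_distrib,
    ← Equiv.prod_comp (Equiv.addRight (1 : ZMod t))
      (fun i => autCard (S i) * hall (N i).out (S i) (A2 i)), ← Finset.prod_mul_distrib]
  refine Finset.prod_congr rfl fun i _ => ?_
  rw [homType_card hfinHom, mul_assoc]
  rfl

variable [HasExt.{0} C]

/-- the local weight -/
def wt (A1 A2 X S : ZMod t → C) (j : ZMod t) (m n : C) : ℚ :=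
  (hall m n (X j) : ℚ) * (autCard m : ℚ) * (autCard n : ℚ) * (homCard (A1 j) (A2 j) : ℚ) /
    ((autCard (X j) : ℚ) * euler (A1 j) (S j) * euler (S (j + 1)) n)

lemma wt_congr (A1 A2 X S : ZMod t → C) (j : ZMod t) {m n m' n' : C} (e : m ≅ m') (e' : n ≅ n') :
    wt A1 A2 X S j m n = wt A1 A2 X S j m' n' := by
  unfold wt
  rw [hall_congr e e', autCard_congr e, autCard_congr e', euler_congr e']

/-- the local condition -/
def locCond {A1 A2 S : ZMod t → C} (X : ZMod t → C) (f : HFam A1 A2 S) (i : ZMod t)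
    (ξ : Ext (A1 (i + 1)) (A2 (i + 1)) 1) : Prop :=
  push (pull (kernel.ι (f (i + 1)).1) ξ) (cokernel.π (f i).1) ∈
      Set.range (cls : sesSet (kernel (f (i + 1)).1) (cokernel (f i).1) (X (i + 1)) → _)

def parEquiv (A1 A2 X S : ZMod t → C) : {q : Par0 A1 A2 // ParCond X S q} ≃
      Σ f : HFam A1 A2 S, {ξ : ∀ i, Ext (A1 i) (A2 i) 1 // ∀ i, locCond X f i (ξ (i + 1))} :=
    { toFun := fun q => ⟨fun i => ⟨q.1.2 i, q.2.2 i⟩, ⟨q.1.1, q.2.1⟩⟩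
      invFun := fun z => ⟨(z.2.1, fun i => (z.1 i).1), z.2.2, fun i => (z.1 i).2⟩
      left_inv := fun _ => rfl
      right_inv := fun _ => rfl }

def shiftEquiv {t : ℕ} (Z : ZMod t → Type) (R : ∀ i, Z (i + 1) → Prop) :
    {ξ : ∀ i, Z i // ∀ i, R i (ξ (i + 1))} ≃ ∀ i, {ξ : Z (i + 1) // R i ξ} :=
  let e : (∀ i, Z i) ≃ ∀ i, Z (i + 1) := (Equiv.piCongrLeft Z (Equiv.addRight (1 : ZMod t))).symm
  (Equiv.subtypeEquiv e (q := fun ξ => ∀ i, R i (ξ i))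
      (fun ξ => Iff.rfl)).trans (Equiv.subtypePiEquivPi (p := fun i ξ => R i ξ))

lemma locCond_card (hfinHom : ∀ X Y : C, Finite (X ⟶ Y))
    (hfinExt : ∀ X Y : C, Finite (Ext X Y 1))
    (hered : ∀ X Y : C, Subsingleton (Ext X Y 2)) (A1 A2 X S : ZMod t → C)
    (f : HFam A1 A2 S) (i : ZMod t) :
    (Nat.card {ξ // locCond X f i ξ} : ℚ) =
      wt A1 A2 X S (i + 1) ((kap f).1 (i + 1)).out ((kap f).2 (i + 1)).out := by
  obtain ⟨σ, hσ, -⟩ := ses_coker (f i).1 (f i).2.some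
  obtain ⟨τ, hτ, -⟩ := ses_ker (f (i + 1)).1 (f (i + 1)).2.some
  have h := local_count hfinHom hfinExt hered σ τ (X (i + 1))
  rw [hσ, hτ] at h
  have hk := (kap_eq_iff f (kap f).1 (kap f).2).1 rfl
  refine Eq.trans h ?_
  exact wt_congr A1 A2 X S (i + 1) (hk (i + 1)).1.some (hk i).2.some

lemma par_card [NeZero t] (hfinHom : ∀ X Y : C, Finite (X ⟶ Y))
    (hfinExt : ∀ X Y : C, Finite (Ext X Y 1))
    (hered : ∀ X Y : C, Subsingleton (Ext X Y 2)) (A1 A2 X S : ZMod t → C)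
    [Fintype (HFam A1 A2 S)] :
    (Nat.card {q : Par0 A1 A2 // ParCond X S q} : ℚ) =
      ∑ f : HFam A1 A2 S, ∏ j, wt A1 A2 X S j ((kap f).1 j).out ((kap f).2 j).out := by
  have hfin : ∀ f : HFam A1 A2 S,
      Finite {ξ : ∀ i, Ext (A1 i) (A2 i) 1 // ∀ i, locCond X f i (ξ (i + 1))} := fun f => by
    have := fun i => hfinExt (A1 i) (A2 i)
    infer_instance
  rw [Nat.card_congr (parEquiv A1 A2 X S), Nat.card_sigma, Nat.cast_sum]
  refine Finset.sum_congr rfl fun f _ => ?_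
  rw [Nat.card_congr (shiftEquiv (fun i => Ext (A1 i) (A2 i) 1) (locCond X f)), Nat.card_pi,
    Nat.cast_prod, ← Equiv.prod_comp (Equiv.addRight (1 : ZMod t))
      (fun j => wt A1 A2 X S j ((kap f).1 j).out ((kap f).2 j).out)]
  exact Finset.prod_congr rfl fun i _ => locCond_card hfinHom hfinExt hered A1 A2 X S f i

end final

theorem cardinality_of_extension_set
    (k : Type) [Field k] [Fintype k]
    (A : Type) [SmallCategory A] [Abelian A] [CategoryTheory.Linear k A]
    [HasExt.{0} A]
    (hfinHom : ∀ X Y : A, Finite (X ⟶ Y))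
    (hfinExt : ∀ X Y : A, Finite (Abelian.Ext X Y 1))
    (hered : ∀ X Y : A, Subsingleton (Abelian.Ext X Y 2))
    (t : ℕ) [NeZero t] (ht : Odd t)
    (A1 A2 X S : ZMod t → A) :
    (Nat.card (eps A1 A2 X S) : ℚ)
      = ∑ᶠ M : ZMod t → IsoCl A, ∑ᶠ N : ZMod t → IsoCl A,
          ∏ i : ZMod t,
            (hall (S (i + 1)) ((M i).out) (A1 i) : ℚ) *
              (hall ((M i).out) ((N i).out) (X i) : ℚ) *
              (hall ((N i).out) (S i) (A2 i) : ℚ) *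
              (autCard ((M i).out) : ℚ) * (autCard ((N i).out) : ℚ) *
              (autCard (S i) : ℚ) * (homCard (A1 i) (A2 i) : ℚ) /
              ((autCard (X i) : ℚ) * euler (A1 i) (S i) *
                euler (S (i + 1)) ((N i).out)) := by
  have hfinH : Finite (HFam A1 A2 S) := by
    have := fun i => hfinHom (A1 i) (A2 (i + 1))
    infer_instance
  have := Fintype.ofFinite (HFam A1 A2 S)
  rw [eps_card, par_card hfinHom hfinExt hered]
  obtain ⟨h1, h2⟩ := sum_fiber (kap : HFam A1 A2 S → _)
    (fun p => ∏ j, wt A1 A2 X S j (p.1 j).out (p.2 j).out)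
  rw [h2, finsum_curry _ h1]
  refine finsum_congr fun M => finsum_congr fun N => ?_
  rw [fiber_card hfinHom, Nat.cast_prod, ← Finset.prod_mul_distrib]
  refine Finset.prod_congr rfl fun i _ => ?_
  unfold wt
  push_cast
  ring

end GreenDH
end
end
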